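/- arXiv:1709.00446 — 3 statements merged into one kernel-verified Lean document; each statement's English description precedes it below -/
import Mathlib

section
/- Let f be an nc self-map of 𝔅_d with f₁(0) = 0, and suppose there is a linear subspace V₁ ⊆ ℂ^d such that the fixed-point set of f₁ in 𝔅_d(1) is exactly V₁ ∩ 𝔅_d(1). Then for every n ≥ 1, the fixed-point set of f_n in 𝔅_d(n) is exactly the set of X ∈ 𝔅_d(n) whose coordinates satisfy all homogeneous linear relations of V₁, i.e., {X ∈ 𝔅_d(n) : for every α ∈ ℂ^d with Σ_j α_j v_j = 0 for all v ∈ V₁, one has Σ_j α_j X_j = 0}. -/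
open Matrix
open scoped ComplexOrder

attribute [local instance] Matrix.normedAddCommGroup Matrix.normedSpace

/-- The space of `d`-tuples of `n × n` complex matrices. -/
abbrev MatTuple (d n : ℕ) := Fin d → Matrix (Fin n) (Fin n) ℂ

/-- The free matrix ball at level `n`: strict row contractions. -/
def freeBall (d n : ℕ) : Set (MatTuple d n) :=
  {X | (1 - ∑ j, X j * (X j)ᴴ).PosDef}

/-- The direct sum of two tuples of matrices. -/
def dSum {d n m : ℕ} (X : MatTuple d n) (Y : MatTuple d m) : MatTuple d (n + m) :=
  fun j => Matrix.reindex finSumFinEquiv finSumFinEquiv (Matrix.fromBlocks (X j) 0 0 (Y j))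

/-- An nc self-map of the free ball `𝔅_d`. -/
structure NCSelfMap (d : ℕ) where
  app : ∀ n, MatTuple d n → MatTuple d n
  mapsTo : ∀ n, Set.MapsTo (app n) (freeBall d n) (freeBall d n)
  map_dSum : ∀ {n m : ℕ} (X : MatTuple d n) (Y : MatTuple d m),
    X ∈ freeBall d n → Y ∈ freeBall d m →
    app (n + m) (dSum X Y) = dSum (app n X) (app m Y)
  map_sim : ∀ {n : ℕ} (X : MatTuple d n) (S : Matrix (Fin n) (Fin n) ℂ),
    X ∈ freeBall d n → IsUnit S →
    (fun j => S⁻¹ * X j * S) ∈ freeBall d n →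
    app n (fun j => S⁻¹ * X j * S) = fun j => S⁻¹ * app n X j * S
  holo : ∀ n, DifferentiableOn ℂ (app n) (freeBall d n)

/-- A tuple is generic if its coordinates generate the full matrix algebra. -/
def IsGeneric {d n : ℕ} (X : MatTuple d n) : Prop :=
  Algebra.adjoin ℂ (Set.range X) = ⊤

/-- The homogeneous degree-one linear relations satisfied by the coordinates of `X`. -/
def linRel {d n : ℕ} (X : MatTuple d n) : Set (Fin d → ℂ) :=
  {α | ∑ j, α j • X j = 0}

/-- The scalar point of level `n` associated to a vector in `ℂ^d`. -/
def scalarPt (d n : ℕ) (v : Fin d → ℂ) : MatTuple d n :=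
  fun j => v j • (1 : Matrix (Fin n) (Fin n) ℂ)

section Abstract

open Metric Set Filter Topology Complex Complex.HadamardThreeLines

variable {E F : Type*} [NormedAddCommGroup E] [NormedSpace ℂ E]
  [NormedAddCommGroup F] [NormedSpace ℂ F]

/-- A uniformly bounded sequence of holomorphic functions on a disc that tends uniformly to zero
on a smaller disc tends to zero at intermediate points. -/
lemma eq_zero_of_uniformly_small {φ : ℕ → ℂ → F} {a : ℕ → ℝ} {v : F} {R ρ M : ℝ}
    (hR : 1 < R) (hρ : 0 < ρ) (hρ1 : ρ < 1)
    (hd : ∀ m, DifferentiableOn ℂ (φ m) (ball 0 R))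
    (hM : ∀ m, ∀ z ∈ ball (0 : ℂ) R, ‖φ m z‖ ≤ M)
    (ha : ∀ m, ∀ z : ℂ, ‖z‖ = ρ → ‖φ m z‖ ≤ a m)
    (hlim : Tendsto a atTop (𝓝 0)) (hv : ∀ m, φ m 1 = v) : v = 0 := by
  obtain ⟨r, hr1, hrR⟩ := exists_between hR
  have hr0 : 0 < r := by linarith
  have hl : Real.log ρ < 0 := Real.log_neg hρ hρ1
  have hu : 0 < Real.log r := Real.log_pos hr1
  have hball : ∀ z : ℂ, z.re ≤ Real.log r → exp z ∈ ball (0 : ℂ) R := fun z hz => by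
    rw [mem_ball_zero_iff, Complex.norm_exp]
    refine lt_of_le_of_lt ?_ hrR
    rwa [← Real.le_log_iff_exp_le hr0]
  set t : ℝ := (0 - Real.log ρ) / (Real.log r - Real.log ρ)
  have ht : t < 1 := by
    rw [div_lt_one (by linarith)]; linarith
  have key : ∀ m, ‖v‖ ≤ a m ^ (1 - t) * M ^ t := fun m => by
    have hdiff : DifferentiableOn ℂ (fun z => φ m (exp z)) (verticalClosedStrip (Real.log ρ)
        (Real.log r)) :=
      (hd m).comp differentiable_exp.differentiableOn fun z hz => hball z hz.2
    have := norm_le_interp_of_mem_verticalClosedStrip' (f := fun z => φ m (exp z)) (z := 0)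
      (a := a m) (b := M) (hl.trans hu) ⟨by simpa using hl.le, by simpa using hu.le⟩
      (DifferentiableOn.diffContOnCl ?_) ⟨M, ?_⟩ ?_ ?_
    · simpa only [exp_zero, hv, zero_re] using this
    · rwa [verticalStrip, closure_preimage_re, closure_Ioo (hl.trans hu).ne]
    · rintro _ ⟨z, hz, rfl⟩
      exact hM m _ (hball z hz.2)
    · intro z hz
      refine ha m _ ?_
      rw [Complex.norm_exp, show z.re = Real.log ρ from hz, Real.exp_log hρ]
    · intro z hz
      exact hM m _ (hball z (le_of_eq hz))
  have hlim' : Tendsto (fun m => a m ^ (1 - t) * M ^ t) atTop (𝓝 0) := by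
    have := (hlim.rpow_const (p := 1 - t) (Or.inr (by linarith))).mul_const (M ^ t)
    rwa [Real.zero_rpow (by linarith), zero_mul] at this
  exact norm_le_zero_iff.1 (ge_of_tendsto' hlim' key)

/-- A linear endomorphism of a finite-dimensional space has a continuous generalized inverse. -/
lemma exists_generalized_inverse [FiniteDimensional ℂ E] (T : E →L[ℂ] E) :
    ∃ S : E →L[ℂ] E, ∀ x, T (S (T x)) = T x := by
  obtain ⟨s, hs⟩ := (T : E →ₗ[ℂ] E).rangeRestrict.exists_rightInverse_of_surjective
    (LinearMap.range_rangeRestrict _)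
  obtain ⟨S, hS⟩ := s.exists_extend
  refine ⟨LinearMap.toContinuousLinearMap S, fun x => ?_⟩
  have h1 := LinearMap.congr_fun hS ((T : E →ₗ[ℂ] E).rangeRestrict x)
  have h2 := congrArg Subtype.val (LinearMap.congr_fun hs ((T : E →ₗ[ℂ] E).rangeRestrict x))
  simp at h1 h2
  simpa [h1] using h2

lemma differentiableOn_iterate {f : E → E} {s : Set E} (hd : DifferentiableOn ℂ f s)
    (hm : MapsTo f s s) (m : ℕ) : DifferentiableOn ℂ f^[m] s := by
  induction m with
  | zero => exact differentiableOn_id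
  | succ k ih => exact ih.comp hd hm

/-- Away from the fixed directions, a self-map of the ball whose derivative is close to a projection
onto those directions is contracting near the origin. -/
lemma exists_contraction_near_zero {g : E → E} {A T S : E →L[ℂ] E}
    (hd : DifferentiableOn ℂ g (ball 0 1)) (h0 : g 0 = 0) (hA : HasFDerivAt g A 0)
    (hS : ∀ x, T (S (T x)) = T x)
    (hfix : ∀ x ∈ ball (0 : E) 1, T x = 0 → g x = x)
    (hsmall : ‖T ∘L A‖ * ‖S‖ ≤ 1 / 4) :
    ∃ δ > 0, ∀ y : E, ‖y‖ ≤ δ → ‖T (g y)‖ ≤ 1 / 2 * ‖T y‖ := by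
  obtain ⟨ε, hε, hεT⟩ : ∃ ε > 0, 4 * ε * ‖T‖ * ‖S‖ ≤ 1 / 4 := by
    refine ⟨1 / (16 * (‖T‖ * ‖S‖ + 1)), by positivity, ?_⟩
    rw [show 4 * (1 / (16 * (‖T‖ * ‖S‖ + 1))) * ‖T‖ * ‖S‖
      = (1 / 4) * ((‖T‖ * ‖S‖) / (‖T‖ * ‖S‖ + 1)) by field_simp; ring]
    have : (‖T‖ * ‖S‖) / (‖T‖ * ‖S‖ + 1) ≤ 1 := by
      rw [div_le_one (by positivity)]; linarith
    linarith
  have hr : ∀ᶠ y in 𝓝 (0 : E), ‖g y - A y‖ ≤ ε * ‖y‖ := by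
    have := hA.isLittleO.def hε
    simpa [h0] using this
  obtain ⟨s₀, hs₀, hs₀r⟩ := Metric.eventually_nhds_iff_ball.1 hr
  obtain ⟨s, hs, hs2⟩ : ∃ s > 0, 2 * s ≤ min s₀ 1 :=
    ⟨min s₀ 1 / 2, by positivity, by linarith⟩
  have hs₀' : 2 * s ≤ s₀ := hs2.trans (min_le_left _ _)
  have hs1' : 2 * s ≤ 1 := hs2.trans (min_le_right _ _)
  have hrem : ∀ w x : E, ‖w‖ ≤ s → ‖x‖ < s →
      ‖(g (w + x) - A (w + x)) - (g w - A w)‖ ≤ 4 * ε * ‖x‖ := by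
    intro w x hw hx
    have hin : ∀ y ∈ ball (0 : E) s, ‖w + y‖ < 2 * s := fun y hy => by
      rw [mem_ball_zero_iff] at hy
      exact (norm_add_le _ _).trans_lt (by linarith)
    have := Complex.dist_le_div_mul_dist_of_mapsTo_ball (f := fun y => g (w + y) - A (w + y))
      (c := (0 : E)) (R₁ := s) (R₂ := 4 * s * ε) (z := x) ?_ ?_ (by simpa using hx)
    · rw [dist_eq_norm, dist_zero_right, add_zero] at this
      refine this.trans (le_of_eq ?_)
      field_simp
    · refine DifferentiableOn.sub (hd.comp (by fun_prop) fun y hy => ?_) (by fun_prop)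
      rw [mem_ball_zero_iff]
      exact (hin y hy).trans_le hs1'
    · have hb : ∀ y ∈ ball (0 : E) s, ‖g (w + y) - A (w + y)‖ ≤ ε * (2 * s) := fun y hy =>
        (hs₀r _ (by rw [mem_ball_zero_iff]; exact (hin y hy).trans_le hs₀')).trans
          (mul_le_mul_of_nonneg_left (hin y hy).le hε.le)
      intro y hy
      rw [mem_closedBall, dist_eq_norm]
      refine (norm_sub_le _ _).trans ?_
      have h1 := hb y hy
      have h2 := hb 0 (by simpa using hs)
      linarith
  refine ⟨s / (2 * (1 + ‖S‖ * ‖T‖)), by positivity, fun y hy => ?_⟩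
  set x := S (T y)
  have hxT : ‖x‖ ≤ ‖S‖ * ‖T y‖ := S.le_opNorm _
  have hyK : (1 + ‖S‖ * ‖T‖) * ‖y‖ ≤ s / 2 := by
    rw [le_div_iff₀ (by positivity)] at hy
    linarith
  have hxy : ‖x‖ ≤ ‖S‖ * ‖T‖ * ‖y‖ := by
    refine hxT.trans ?_
    rw [mul_assoc]
    exact mul_le_mul_of_nonneg_left (T.le_opNorm _) (norm_nonneg _)
  have hy0 := norm_nonneg y
  have hxs : ‖x‖ < s := by nlinarith
  have hws : ‖y - x‖ ≤ s := (norm_sub_le _ _).trans (by nlinarith)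
  have hTw : T (y - x) = 0 := by rw [map_sub, hS, sub_self]
  have hgw : g (y - x) = y - x := hfix _ (by rw [mem_ball_zero_iff]; linarith) hTw
  have hrx := hrem (y - x) x hws hxs
  rw [sub_add_cancel] at hrx
  have hdec : T (g y) = (T ∘L A) x + T ((g y - A y) - (g (y - x) - A (y - x))) := by
    simp only [map_sub, hgw, ContinuousLinearMap.comp_apply] at hTw ⊢
    rw [← sub_eq_zero] at hTw ⊢
    rw [← sub_eq_zero.1 hTw]
    abel_nf
  rw [hdec]
  have h1 : ‖(T ∘L A) x‖ ≤ ‖T ∘L A‖ * (‖S‖ * ‖T y‖) :=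
    ((T ∘L A).le_opNorm _).trans (mul_le_mul_of_nonneg_left hxT (norm_nonneg _))
  have h2 : ‖T ((g y - A y) - (g (y - x) - A (y - x)))‖ ≤ ‖T‖ * (4 * ε * (‖S‖ * ‖T y‖)) := by
    refine (T.le_opNorm _).trans (mul_le_mul_of_nonneg_left (hrx.trans ?_) (norm_nonneg _))
    exact mul_le_mul_of_nonneg_left hxT (by positivity)
  refine (norm_add_le _ _).trans ?_
  nlinarith [norm_nonneg (T y)]

/-- The fixed points of a holomorphic self-map of the unit ball fixing the origin are fixed by its
derivative at the origin, as soon as the converse holds. -/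
theorem fderiv_apply_eq_self_of_fixed [FiniteDimensional ℂ E] {f : E → E} {L : E →L[ℂ] E}
    (hd : DifferentiableOn ℂ f (ball 0 1)) (hm : MapsTo f (ball 0 1) (ball 0 1)) (h0 : f 0 = 0)
    (hL : HasFDerivAt f L 0)
    (hfix : ∀ x ∈ ball (0 : E) 1, L x = x → f x = x)
    {x : E} (hx : x ∈ ball (0 : E) 1) (hfx : f x = x) : L x = x := by
  set T : E →L[ℂ] E := 1 - L with hT
  obtain ⟨S, hS⟩ := exists_generalized_inverse T
  have hmi : ∀ m, MapsTo f^[m] (ball 0 1) (ball 0 1) := fun m => hm.iterate m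
  have hLm : ∀ m, ‖L ^ m‖ ≤ 1 := fun m => by
    rw [← (hL.iterate h0 m).fderiv]
    refine Complex.norm_fderiv_le_one_of_mapsTo_ball (differentiableOn_iterate hd hm m) ?_
      one_pos
    rw [Function.iterate_fixed h0]
    exact (hmi m).mono_right ball_subset_closedBall
  obtain ⟨N, hN⟩ := exists_nat_gt (8 * ‖S‖)
  have hN0 : (0 : ℝ) < N := (by positivity : (0 : ℝ) ≤ 8 * ‖S‖).trans_lt hN
  have hNc : (N : ℂ) ≠ 0 := by exact_mod_cast hN0.ne'
  set g : E → E := fun y => (N : ℂ)⁻¹ • ∑ m ∈ Finset.range N, f^[m] y with hg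
  set A : E →L[ℂ] E := (N : ℂ)⁻¹ • ∑ m ∈ Finset.range N, L ^ m with hAdef
  have hgd : DifferentiableOn ℂ g (ball 0 1) :=
    (DifferentiableOn.fun_sum fun m _ => differentiableOn_iterate hd hm m).const_smul _
  have hgfix : ∀ y, f y = y → g y = y := fun y hy => by
    simp only [hg, Function.iterate_fixed hy, Finset.sum_const, Finset.card_range]
    rw [← Nat.cast_smul_eq_nsmul ℂ, smul_smul, inv_mul_cancel₀ hNc, one_smul]
  have hgm : MapsTo g (ball 0 1) (ball 0 1) := fun y hy => by
    have hle : ∀ m, ‖f^[m] y‖ ≤ ‖y‖ := fun m =>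
      Complex.norm_le_norm_of_mapsTo_ball (differentiableOn_iterate hd hm m)
        ((hmi m).mono_right ball_subset_closedBall) (Function.iterate_fixed h0 m)
        (by simpa using hy)
    have hs : ‖∑ m ∈ Finset.range N, f^[m] y‖ ≤ N * ‖y‖ := by
      simpa using norm_sum_le_of_le (Finset.range N) fun m _ => hle m
    rw [mem_ball_zero_iff] at hy ⊢
    refine lt_of_le_of_lt ?_ hy
    rw [norm_smul, norm_inv, Complex.norm_natCast, inv_mul_le_iff₀ hN0]
    exact hs
  have hg0 : g 0 = 0 := hgfix 0 h0
  have hgA : HasFDerivAt g A 0 :=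
    (HasFDerivAt.fun_sum fun m _ => hL.iterate h0 m).const_smul _
  have hTA : T ∘L A = (N : ℂ)⁻¹ • (1 - L ^ N) := by
    rw [hAdef, ContinuousLinearMap.comp_smul, hT, ← mul_neg_geom_sum]
    rfl
  have hsmall : ‖T ∘L A‖ * ‖S‖ ≤ 1 / 4 := by
    have h2 : ‖(1 : E →L[ℂ] E) - L ^ N‖ ≤ 2 := by
      refine (norm_sub_le _ _).trans ?_
      have := hLm 0
      rw [pow_zero] at this
      linarith [hLm N]
    rw [hTA, norm_smul, norm_inv, Complex.norm_natCast, mul_assoc, inv_mul_le_iff₀ hN0]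
    nlinarith [norm_nonneg S]
  have hTfix : ∀ y ∈ ball (0 : E) 1, T y = 0 → g y = y := fun y hy hTy =>
    hgfix y (hfix y hy (sub_eq_zero.1 hTy).symm)
  obtain ⟨δ, hδ, hcontr⟩ := exists_contraction_near_zero hgd hg0 hgA hS hTfix hsmall
  suffices T x = 0 from (sub_eq_zero.1 this).symm
  rcases eq_or_ne x 0 with rfl | hx0
  · simp
  have hxpos : 0 < ‖x‖ := norm_pos_iff.2 hx0
  rw [mem_ball_zero_iff] at hx
  have hzx : ∀ z ∈ ball (0 : ℂ) (1 / ‖x‖), z • x ∈ ball (0 : E) 1 := fun z hz => by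
    rw [mem_ball_zero_iff] at hz ⊢
    rwa [norm_smul, ← lt_div_iff₀ hxpos]
  have hgnorm : ∀ m, ∀ y ∈ ball (0 : E) 1, ‖g^[m] y‖ ≤ ‖y‖ := fun m y hy =>
    Complex.norm_le_norm_of_mapsTo_ball (differentiableOn_iterate hgd hgm m)
      ((hgm.iterate m).mono_right ball_subset_closedBall) (Function.iterate_fixed hg0 m)
      (by simpa using hy)
  obtain ⟨η, hη0, hη⟩ : ∃ η > 0, η ≤ min δ (‖x‖ / 2) := ⟨_, by positivity, le_rfl⟩
  have hη1 := hη.trans (min_le_left _ _)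
  have hη2 := hη.trans (min_le_right _ _)
  refine eq_zero_of_uniformly_small (φ := fun m z => T (g^[m] (z • x))) (R := 1 / ‖x‖)
    (ρ := η / ‖x‖) (M := ‖T‖) (a := fun m => (1 / 2) ^ m * ‖T‖) ?_ (by positivity) ?_ ?_ ?_ ?_ ?_ ?_
  · rwa [lt_div_iff₀ hxpos, one_mul]
  · rw [div_lt_one hxpos]; linarith
  · intro m
    exact T.differentiable.comp_differentiableOn
      ((differentiableOn_iterate hgd hgm m).comp (by fun_prop) hzx)
  · intro m z hz
    refine (T.le_opNorm _).trans (mul_le_of_le_one_right (norm_nonneg _) ?_)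
    exact (mem_ball_zero_iff.1 (hgm.iterate m (hzx z hz))).le
  · intro m z hz
    have hy : ‖z • x‖ = η := by rw [norm_smul, hz, div_mul_cancel₀ _ hxpos.ne']
    have hy1 : z • x ∈ ball (0 : E) 1 := by rw [mem_ball_zero_iff, hy]; linarith
    have : ‖T (g^[m] (z • x))‖ ≤ (1 / 2) ^ m * ‖T (z • x)‖ := by
      induction m with
      | zero => simp
      | succ k ih =>
        rw [Function.iterate_succ_apply']
        refine (hcontr _ ((hgnorm k _ hy1).trans (hy.trans_le hη1))).trans ?_
        rw [pow_succ']
        linarith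
    refine this.trans (mul_le_mul_of_nonneg_left ?_ (by positivity))
    exact (T.le_opNorm _).trans (mul_le_of_le_one_right (norm_nonneg _)
      (mem_ball_zero_iff.1 hy1).le)
  · simpa using (tendsto_pow_atTop_nhds_zero_of_lt_one (r := (1 / 2 : ℝ)) (by norm_num)
      (by norm_num)).mul_const ‖T‖
  · intro m
    simp only [one_smul]
    rw [Function.iterate_fixed (hgfix x hfx)]

end Abstract

section Ball

variable {d n : ℕ}

lemma sum_norm_vecMul_sq (X : MatTuple d n) (ξ : Fin n → ℂ) :
    ((∑ j, ∑ k, ‖(ξ ᵥ* X j) k‖ ^ 2 : ℝ) : ℂ) = ξ ⬝ᵥ ((∑ j, X j * (X j)ᴴ) *ᵥ star ξ) := by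
  rw [Matrix.sum_mulVec, dotProduct_sum]
  push_cast
  refine Finset.sum_congr rfl fun j _ => ?_
  rw [← Matrix.mulVec_mulVec, dotProduct_mulVec, ← star_vecMul]
  simp [dotProduct, Complex.mul_conj']

lemma mem_freeBall_iff {X : MatTuple d n} : X ∈ freeBall d n ↔
    ∀ ξ : Fin n → ℂ, ξ ≠ 0 → ∑ j, ∑ k, ‖(ξ ᵥ* X j) k‖ ^ 2 < ∑ i, ‖ξ i‖ ^ 2 := by
  have hH : (1 - ∑ j, X j * (X j)ᴴ).IsHermitian := by
    refine Matrix.isHermitian_one.sub ?_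
    simp [Matrix.IsHermitian, Matrix.conjTranspose_sum]
  have key : ∀ ξ : Fin n → ℂ, star (star ξ) ⬝ᵥ ((1 - ∑ j, X j * (X j)ᴴ) *ᵥ star ξ) =
      ((∑ i, ‖ξ i‖ ^ 2 - ∑ j, ∑ k, ‖(ξ ᵥ* X j) k‖ ^ 2 : ℝ) : ℂ) := fun ξ => by
    rw [star_star, Matrix.sub_mulVec, dotProduct_sub, ← sum_norm_vecMul_sq, Complex.ofReal_sub]
    simp [dotProduct, Complex.mul_conj']
  rw [freeBall, Set.mem_ofPred_eq, posDef_iff_dotProduct_mulVec]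
  constructor
  · rintro ⟨-, h⟩ ξ hξ
    have := h (x := star ξ) (by simpa using hξ)
    rw [key] at this
    exact sub_pos.1 (Complex.zero_lt_real.1 this)
  · refine fun h => ⟨hH, fun x hx => ?_⟩
    have := h (star x) (by simpa using hx)
    have hk := key (star x)
    simp only [star_star] at hk
    rw [hk, Complex.zero_lt_real]
    exact sub_pos.2 this

/-- Tuples of matrices as operators, so that the free ball becomes an operator norm ball. -/
noncomputable def tupleEquiv (d n : ℕ) : MatTuple d n ≃L[ℂ]
    (EuclideanSpace ℂ (Fin n) →L[ℂ] EuclideanSpace ℂ (Fin d × Fin n)) :=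
  LinearEquiv.toContinuousLinearEquiv <|
    (show MatTuple d n ≃ₗ[ℂ] Matrix (Fin d × Fin n) (Fin n) ℂ from
      { toFun := fun X => Matrix.of fun p i => X p.1 i p.2
        invFun := fun M j => Matrix.of fun i k => M (j, k) i
        map_add' := fun _ _ => rfl
        map_smul' := fun _ _ => rfl
        left_inv := fun _ => rfl
        right_inv := fun _ => rfl }) ≪≫ₗ
    Matrix.toEuclideanLin ≪≫ₗ LinearMap.toContinuousLinearMap

lemma tupleEquiv_apply (X : MatTuple d n) (ξ : EuclideanSpace ℂ (Fin n)) (j : Fin d) (k : Fin n) :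
    tupleEquiv d n X ξ (j, k) = (ξ.ofLp ᵥ* X j) k := by
  simp only [Matrix.vecMul, dotProduct, mul_comm (ξ.ofLp _)]
  rfl

lemma norm_tupleEquiv_apply_sq (X : MatTuple d n) (ξ : EuclideanSpace ℂ (Fin n)) :
    ‖tupleEquiv d n X ξ‖ ^ 2 = ∑ j, ∑ k, ‖(ξ.ofLp ᵥ* X j) k‖ ^ 2 := by
  rw [EuclideanSpace.norm_sq_eq, Fintype.sum_prod_type]
  simp only [tupleEquiv_apply]

lemma mem_freeBall_iff_norm_lt_one {X : MatTuple d n} :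
    X ∈ freeBall d n ↔ ‖tupleEquiv d n X‖ < 1 := by
  rw [mem_freeBall_iff]
  constructor
  · intro h
    rcases isEmpty_or_nonempty (Fin n) with hn | hn
    · rw [Subsingleton.elim (tupleEquiv d n X) 0]
      simp
    obtain ⟨ξ, hξ, hmax⟩ := (isCompact_sphere (0 : EuclideanSpace ℂ (Fin n)) 1).exists_isMaxOn
      (NormedSpace.sphere_nonempty.2 zero_le_one) (f := fun ξ => ‖tupleEquiv d n X ξ‖)
      (by fun_prop)
    have hξ1 : ‖ξ‖ = 1 := by simpa using hξ
    refine lt_of_le_of_lt (ContinuousLinearMap.opNorm_le_of_unit_norm (norm_nonneg _)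
      fun x hx => hmax (by simpa using hx)) ?_
    have := h ξ.ofLp (fun h0 => by
      have : ξ = 0 := by ext i; exact congrFun h0 i
      simp [this] at hξ1)
    rw [← norm_tupleEquiv_apply_sq, ← EuclideanSpace.norm_sq_eq, hξ1] at this
    exact lt_of_pow_lt_pow_left₀ 2 zero_le_one this
  · intro h ξ hξ
    set η : EuclideanSpace ℂ (Fin n) := WithLp.toLp 2 ξ
    have hη : 0 < ‖η‖ := norm_pos_iff.2 fun h0 => hξ (congrArg WithLp.ofLp h0)
    have := norm_tupleEquiv_apply_sq X η
    rw [← show η.ofLp = ξ from rfl, ← this, ← EuclideanSpace.norm_sq_eq]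
    refine pow_lt_pow_left₀ ?_ (norm_nonneg _) two_ne_zero
    refine ((tupleEquiv d n X).le_opNorm η).trans_lt ?_
    nlinarith

lemma isOpen_freeBall : IsOpen (freeBall d n) := by
  have : freeBall d n = tupleEquiv d n ⁻¹' Metric.ball 0 1 := by
    ext X; simp [mem_freeBall_iff_norm_lt_one]
  rw [this]
  exact Metric.isOpen_ball.preimage (tupleEquiv d n).continuous

lemma zero_mem_freeBall : (0 : MatTuple d n) ∈ freeBall d n := by
  simp [mem_freeBall_iff_norm_lt_one]

lemma freeBall_mem_nhds_zero : freeBall d n ∈ nhds (0 : MatTuple d n) :=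
  isOpen_freeBall.mem_nhds zero_mem_freeBall

/-- Every tuple has a nonzero multiple in the free ball. -/
lemma exists_smul_mem_freeBall (X : MatTuple d n) : ∃ t : ℂ, t ≠ 0 ∧ t • X ∈ freeBall d n := by
  have h : Filter.Tendsto (fun t : ℂ => t • X) (nhdsWithin 0 {0}ᶜ) (nhds 0) := by
    refine Filter.Tendsto.mono_left ?_ nhdsWithin_le_nhds
    exact Continuous.tendsto' (by fun_prop) _ _ (by simp)
  obtain ⟨t, ht, ht0⟩ := ((h.eventually_mem freeBall_mem_nhds_zero).and self_mem_nhdsWithin).exists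
  exact ⟨t, ht0, ht⟩

end Ball

section Derivative

variable {d : ℕ}

/-- A linear equivariance of two maps passes to their derivatives at the origin. -/
lemma HasFDerivAt.comp_eq_of_equivariant {E E' : Type*} [NormedAddCommGroup E] [NormedSpace ℂ E]
    [NormedAddCommGroup E'] [NormedSpace ℂ E'] {f : E → E} {f' : E' → E'} {L : E →L[ℂ] E}
    {L' : E' →L[ℂ] E'} (Φ : E →L[ℂ] E') (hf : HasFDerivAt f L 0) (hf' : HasFDerivAt f' L' 0)
    (h : ∀ᶠ x in nhds 0, f' (Φ x) = Φ (f x)) (x : E) : L' (Φ x) = Φ (L x) := by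
  have h1 : HasFDerivAt (fun x => Φ (f x)) (Φ ∘L L) 0 := Φ.hasFDerivAt.comp 0 hf
  have h2 : HasFDerivAt (fun x => f' (Φ x)) (L' ∘L Φ) 0 := by
    rw [← map_zero Φ] at hf'
    exact hf'.comp 0 Φ.hasFDerivAt
  exact DFunLike.congr_fun (h2.unique (h1.congr_of_eventuallyEq h)) x

namespace NCSelfMap

variable (f : NCSelfMap d)

/-- The derivative at the origin of an nc self-map, at level `n`. -/
noncomputable def derivZero (n : ℕ) : MatTuple d n →L[ℂ] MatTuple d n := fderiv ℂ (f.app n) 0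

lemma differentiableAt {n : ℕ} {X : MatTuple d n} (hX : X ∈ freeBall d n) :
    DifferentiableAt ℂ (f.app n) X :=
  (f.holo n).differentiableAt (isOpen_freeBall.mem_nhds hX)

lemma hasFDerivAt_derivZero (n : ℕ) : HasFDerivAt (f.app n) (f.derivZero n) 0 :=
  (f.differentiableAt zero_mem_freeBall).hasFDerivAt

lemma app_zero (hf0 : f.app 1 0 = 0) (n : ℕ) : f.app n 0 = 0 := by
  induction n with
  | zero => exact Subsingleton.elim _ _
  | succ n ih =>
    have h0 : (0 : MatTuple d (n + 1)) = dSum (0 : MatTuple d n) (0 : MatTuple d 1) := by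
      ext j : 1
      simp [dSum]
    conv_lhs => rw [h0]
    rw [f.map_dSum _ _ zero_mem_freeBall zero_mem_freeBall, ih, hf0, ← h0]

/-- The inclusion of level `m` as the second summand of level `n + m`. -/
noncomputable def inclRight (n m : ℕ) : MatTuple d m →L[ℂ] MatTuple d (n + m) :=
  LinearMap.toContinuousLinearMap
    { toFun := fun X => dSum (0 : MatTuple d n) X
      map_add' := fun X Y => by
        ext j p q
        refine Fin.addCases (fun p => ?_) (fun p => ?_) p <;>
        refine Fin.addCases (fun q => ?_) (fun q => ?_) q <;>
        simp [dSum]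
      map_smul' := fun c X => by
        ext j p q
        refine Fin.addCases (fun p => ?_) (fun p => ?_) p <;>
        refine Fin.addCases (fun q => ?_) (fun q => ?_) q <;>
        simp [dSum] }

/-- Simultaneous conjugation of a tuple. -/
noncomputable def conjMap {n : ℕ} (S : Matrix (Fin n) (Fin n) ℂ) :
    MatTuple d n →L[ℂ] MatTuple d n :=
  LinearMap.toContinuousLinearMap
    { toFun := fun X j => S⁻¹ * X j * S
      map_add' := fun X Y => by
        ext j : 1
        simp [mul_add, add_mul]
      map_smul' := fun c X => by
        ext j : 1
        simp }

lemma derivZero_dSum (hf0 : f.app 1 0 = 0) (n m : ℕ) (X : MatTuple d m) :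
    f.derivZero (n + m) (dSum (0 : MatTuple d n) X) =
      dSum (0 : MatTuple d n) (f.derivZero m X) := by
  refine (f.hasFDerivAt_derivZero m).comp_eq_of_equivariant (inclRight n m)
    (f.hasFDerivAt_derivZero (n + m)) ?_ X
  filter_upwards [freeBall_mem_nhds_zero] with Y hY
  have := f.map_dSum (0 : MatTuple d n) Y zero_mem_freeBall hY
  rwa [f.app_zero hf0] at this

lemma derivZero_conj {n : ℕ} (S : Matrix (Fin n) (Fin n) ℂ) (hS : IsUnit S) (X : MatTuple d n) :
    f.derivZero n (fun j => S⁻¹ * X j * S) = fun j => S⁻¹ * f.derivZero n X j * S := by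
  refine (f.hasFDerivAt_derivZero n).comp_eq_of_equivariant (conjMap S)
    (f.hasFDerivAt_derivZero n) ?_ X
  have hc : Filter.Tendsto (conjMap (d := d) S) (nhds 0) (nhds 0) :=
    (conjMap S).continuous.tendsto' _ _ (map_zero _)
  filter_upwards [freeBall_mem_nhds_zero, hc freeBall_mem_nhds_zero] with Y hY hY'
  exact f.map_sim Y S hY hS hY'

/-- The derivative at the origin at level one, as an endomorphism of `ℂ^d`. -/
noncomputable def linPart : (Fin d → ℂ) →ₗ[ℂ] (Fin d → ℂ) where
  toFun v i := f.derivZero 1 (scalarPt d 1 v) i 0 0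
  map_add' v w := by
    have : scalarPt d 1 (v + w) = scalarPt d 1 v + scalarPt d 1 w := by
      ext j : 1; simp [scalarPt, add_smul]
    ext i; simp [this]
  map_smul' c v := by
    have : scalarPt d 1 (c • v) = c • scalarPt d 1 v := by
      ext j : 1; simp [scalarPt, mul_smul]
    ext i; simp [this]

/-- The matrix `M` satisfies: the derivative at the origin acts on elementary tensors `v ⊗ M`
through `v` alone. -/
def ActsOnLeft (n : ℕ) (M : Matrix (Fin n) (Fin n) ℂ) : Prop :=
  ∀ v : Fin d → ℂ, f.derivZero n (fun j => v j • M) = fun j => f.linPart v j • M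

variable {f} {n : ℕ}

lemma ActsOnLeft.add {M N : Matrix (Fin n) (Fin n) ℂ} (hM : f.ActsOnLeft n M)
    (hN : f.ActsOnLeft n N) : f.ActsOnLeft n (M + N) := fun v => by
  have : (fun j => v j • (M + N)) = (fun j => v j • M) + fun j => v j • N := by
    ext j : 1; simp
  rw [this, map_add, hM v, hN v]
  ext j : 1; simp

lemma ActsOnLeft.neg {M : Matrix (Fin n) (Fin n) ℂ} (hM : f.ActsOnLeft n M) :
    f.ActsOnLeft n (-M) := fun v => by
  have : (fun j => v j • (-M)) = -(fun j => v j • M) := by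
    ext j : 1; simp
  rw [this, map_neg, hM v]
  ext j : 1; simp

lemma ActsOnLeft.sub {M N : Matrix (Fin n) (Fin n) ℂ} (hM : f.ActsOnLeft n M)
    (hN : f.ActsOnLeft n N) : f.ActsOnLeft n (M - N) := by
  rw [sub_eq_add_neg]
  exact hM.add hN.neg

lemma ActsOnLeft.conj_one_add_single {M : Matrix (Fin n) (Fin n) ℂ} (hM : f.ActsOnLeft n M)
    {r s : Fin n} (hrs : r ≠ s) :
    f.ActsOnLeft n ((1 - single r s 1) * M * (1 + single r s 1)) := fun v => by
  have hinv : (1 + single r s (1 : ℂ)) * (1 - single r s 1) = 1 := by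
    simp [add_mul, mul_sub, single_mul_single_of_ne _ _ _ _ hrs.symm]
  have hu : IsUnit (1 + single r s (1 : ℂ)) := IsUnit.of_mul_eq_one _ hinv
  have := f.derivZero_conj _ hu (fun j => v j • M)
  rw [hM v, Matrix.inv_eq_right_inv hinv] at this
  simpa only [Matrix.mul_smul, Matrix.smul_mul] using this

lemma actsOnLeft_single (hf0 : f.app 1 0 = 0) (k l : Fin (n + 1)) :
    f.ActsOnLeft (n + 1) (single k l 1) := by
  set a := Fin.last n
  have ha : f.ActsOnLeft (n + 1) (single a a 1) := fun v => by
    have hs : ∀ w : Fin d → ℂ, (fun j => w j • single a a (1 : ℂ)) =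
        dSum (0 : MatTuple d n) (scalarPt d 1 w) := fun w => by
      ext j p q
      refine Fin.addCases (fun p => ?_) (fun p => ?_) p <;>
      refine Fin.addCases (fun q => ?_) (fun q => ?_) q
      · simp [dSum, a, Fin.ext_iff, p.isLt.ne']
      · simp [dSum, a, Fin.ext_iff, p.isLt.ne']
      · simp [dSum, a, Fin.ext_iff, q.isLt.ne']
      · rw [Subsingleton.elim p 0, Subsingleton.elim q 0]
        simp [dSum, scalarPt, single_apply, a, Fin.ext_iff]
    have h1 : f.derivZero 1 (scalarPt d 1 v) = scalarPt d 1 (f.linPart v) := by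
      ext j p q
      rw [Subsingleton.elim p 0, Subsingleton.elim q 0]
      simp [scalarPt, linPart]
    rw [hs, f.derivZero_dSum hf0, h1, hs]
  have hrow : ∀ l, f.ActsOnLeft (n + 1) (single a l 1) := fun l => by
    rcases eq_or_ne l a with rfl | hl
    · exact ha
    have := (ha.conj_one_add_single hl.symm).sub ha
    convert this using 1
    simp [sub_mul, mul_add, single_mul_single_of_ne _ _ _ _ hl]
  have hoff : ∀ k l, k ≠ l → f.ActsOnLeft (n + 1) (single k l 1) := fun k l hkl => by
    rcases eq_or_ne k a with rfl | hk
    · exact hrow l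
    have := (hrow l).sub ((hrow l).conj_one_add_single hk)
    convert this using 1
    simp [sub_mul, mul_add, single_mul_single_of_ne _ _ _ _ hkl.symm]
  rcases ne_or_eq k l with hkl | rfl
  · exact hoff k l hkl
  rcases eq_or_ne k a with rfl | hk
  · exact ha
  have := (((hrow k).add ha).sub (hoff k a hk)).sub ((hrow k).conj_one_add_single hk)
  convert this using 1
  simp [sub_mul, mul_add]
  abel_nf

variable (f) in
/-- The derivative at the origin is the entrywise application of its level one part. -/
lemma derivZero_apply (hf0 : f.app 1 0 = 0) (X : MatTuple d n) (i : Fin d) (k l : Fin n) :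
    f.derivZero n X i k l = f.linPart (fun j => X j k l) i := by
  obtain _ | n := n
  · exact k.elim0
  have hX : X = ∑ p, ∑ q, fun j => X j p q • single p q (1 : ℂ) := by
    ext j : 1
    conv_lhs => rw [matrix_eq_sum_single (X j)]
    simp [Finset.sum_apply, Matrix.smul_single]
  conv_lhs => rw [hX]
  simp only [map_sum, actsOnLeft_single hf0 _ _ _, Finset.sum_apply, Matrix.sum_apply,
    Matrix.smul_apply, Matrix.single_apply]
  simp [ite_and]

lemma derivZero_apply_eq_self_iff (hf0 : f.app 1 0 = 0) (X : MatTuple d n) :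
    f.derivZero n X = X ↔ ∀ k l, f.linPart (fun j => X j k l) = fun j => X j k l := by
  simp only [funext_iff, ← Matrix.ext_iff, f.derivZero_apply hf0]
  exact ⟨fun h k l j => h j k l, fun h j k l => h k l j⟩

end NCSelfMap

end Derivative

section BlockRow

variable {d n : ℕ}

/-- The tuple of block matrices with top row `X, B` and zero bottom row. -/
def blockRow (X B : MatTuple d n) : MatTuple d (n + n) :=
  fun j => Matrix.reindex finSumFinEquiv finSumFinEquiv (Matrix.fromBlocks (X j) (B j) 0 0)

section Entries

variable (X B : MatTuple d n) (j : Fin d) (i k : Fin n) (q : Fin (n + n))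

@[simp] lemma blockRow_castAdd_castAdd :
    blockRow X B j (Fin.castAdd n i) (Fin.castAdd n k) = X j i k := by simp [blockRow]

@[simp] lemma blockRow_castAdd_natAdd :
    blockRow X B j (Fin.castAdd n i) (Fin.natAdd n k) = B j i k := by
  simp [blockRow, -Fin.natAdd_eq_addNat]

@[simp] lemma blockRow_natAdd : blockRow X B j (Fin.natAdd n i) q = 0 := by
  refine Fin.addCases (fun q => ?_) (fun q => ?_) q <;> simp [blockRow, -Fin.natAdd_eq_addNat]

end Entries

lemma blockRow_smul (c : ℂ) (X B : MatTuple d n) :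
    c • blockRow X B = blockRow (c • X) (c • B) := by
  ext j p q
  refine Fin.addCases (fun p => ?_) (fun p => ?_) p <;>
  refine Fin.addCases (fun q => ?_) (fun q => ?_) q <;> simp [-Fin.natAdd_eq_addNat]

lemma blockRow_zero (X : MatTuple d n) : blockRow X 0 = dSum X (0 : MatTuple d n) := rfl

lemma sum_norm_vecMul_blockRow_sq (X B : MatTuple d n) (ξ : Fin (n + n) → ℂ) :
    ∑ j, ∑ k, ‖(ξ ᵥ* blockRow X B j) k‖ ^ 2 =
      ∑ j, ∑ k, ‖((fun i => ξ (Fin.castAdd n i)) ᵥ* X j) k‖ ^ 2 +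
      ∑ j, ∑ k, ‖((fun i => ξ (Fin.castAdd n i)) ᵥ* B j) k‖ ^ 2 := by
  rw [← Finset.sum_add_distrib]
  simp [Fin.sum_univ_add, Matrix.vecMul, dotProduct, -Fin.natAdd_eq_addNat]

lemma blockRow_smul_mem_freeBall {X B : MatTuple d n} (h : blockRow X B ∈ freeBall d (n + n))
    {t : ℂ} (ht : ‖t‖ ≤ 1) : blockRow X (t • B) ∈ freeBall d (n + n) := by
  rw [mem_freeBall_iff] at h ⊢
  refine fun ξ hξ => lt_of_le_of_lt ?_ (h ξ hξ)
  rw [sum_norm_vecMul_blockRow_sq, sum_norm_vecMul_blockRow_sq]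
  gcongr with j _ k _
  simp only [Pi.smul_apply, Matrix.vecMul_smul, norm_smul]
  exact mul_le_of_le_one_left (norm_nonneg _) ht

open scoped MatrixOrder in
lemma Matrix.PosSemidef.exists_eq_conjTranspose_mul_self {m : Type*} [Fintype m]
    {A : Matrix m m ℂ} (hA : A.PosSemidef) : ∃ C : Matrix m m ℂ, A = Cᴴ * C := by
  classical
  obtain ⟨C, hC, -, rfl⟩ := CFC.exists_sqrt_of_isSelfAdjoint_of_quasispectrumRestricts
    hA.isHermitian (QuasispectrumRestricts.nnreal_of_nonneg hA.nonneg)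
  exact ⟨C, by rw [← Matrix.star_eq_conjTranspose, hC.star_eq]⟩

/-- A strict row contraction can be completed to a coisometric row along any unit vector. -/
lemma exists_completion {X : MatTuple d n} (hX : X ∈ freeBall d n) {w : Fin d → ℂ}
    (hw : ∑ j, ‖w j‖ ^ 2 = 1) : ∃ D : Matrix (Fin n) (Fin n) ℂ, ∀ η : Fin n → ℂ,
      ∑ j, ∑ k, ‖(η ᵥ* X j) k‖ ^ 2 + ∑ j, ∑ k, ‖(η ᵥ* (w j • D)) k‖ ^ 2 = ∑ i, ‖η i‖ ^ 2 := by
  obtain ⟨C, hC⟩ := Matrix.PosSemidef.exists_eq_conjTranspose_mul_self (Matrix.PosDef.posSemidef hX)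
  refine ⟨Cᴴ, fun η => ?_⟩
  have hD : ∑ j, (w j • Cᴴ) * (w j • Cᴴ)ᴴ = 1 - ∑ j, X j * (X j)ᴴ := by
    have hw' : ∑ j, star (w j) * w j = 1 := by
      have := congrArg (Complex.ofReal) hw
      push_cast at this
      simpa [Complex.conj_mul'] using this
    rw [hC]
    simp only [Matrix.conjTranspose_smul, Matrix.conjTranspose_conjTranspose, Matrix.smul_mul,
      Matrix.mul_smul, smul_smul, ← Finset.sum_smul]
    rw [hw', one_smul]
  apply Complex.ofReal_injective
  rw [Complex.ofReal_add, sum_norm_vecMul_sq, sum_norm_vecMul_sq (fun j => w j • Cᴴ), hD,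
    ← dotProduct_add, ← Matrix.add_mulVec, add_sub_cancel, Matrix.one_mulVec]
  simp [dotProduct, Complex.mul_conj']

namespace NCSelfMap

variable (f : NCSelfMap d)

lemma app_blockRow_smul_corner {X B : MatTuple d n} (h : blockRow X B ∈ freeBall d (n + n))
    {t : ℂ} (ht0 : t ≠ 0) (ht : ‖t‖ ≤ 1) (j : Fin d) (i k : Fin n) :
    f.app (n + n) (blockRow X (t • B)) j (Fin.castAdd n i) (Fin.castAdd n k) =
      f.app (n + n) (blockRow X B) j (Fin.castAdd n i) (Fin.castAdd n k) := by
  set s : Fin (n + n) → ℂ := Fin.addCases (fun _ => 1) (fun _ => t) with hs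
  have hs0 : ∀ p, s p ≠ 0 := fun p => by
    refine Fin.addCases (fun p => ?_) (fun p => ?_) p <;> simp [hs, ht0, -Fin.natAdd_eq_addNat]
  have hinv : Matrix.diagonal s * Matrix.diagonal (fun p => (s p)⁻¹) = 1 := by
    simp [hs0]
  have hconj : (fun j => (Matrix.diagonal s)⁻¹ * blockRow X B j * Matrix.diagonal s) =
      blockRow X (t • B) := by
    ext j p q
    rw [Matrix.inv_eq_right_inv hinv, Matrix.mul_diagonal, Matrix.diagonal_mul]
    refine Fin.addCases (fun p => ?_) (fun p => ?_) p <;>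
    refine Fin.addCases (fun q => ?_) (fun q => ?_) q <;> simp [hs, mul_comm, -Fin.natAdd_eq_addNat]
  have := f.map_sim (blockRow X B) (Matrix.diagonal s) h (IsUnit.of_mul_eq_one _ hinv)
    (by rw [hconj]; exact blockRow_smul_mem_freeBall h ht)
  rw [hconj] at this
  refine (congrFun (congrFun (congrFun this j) _) _).trans ?_
  rw [Matrix.inv_eq_right_inv hinv, Matrix.mul_diagonal, Matrix.diagonal_mul]
  simp [hs]

/-- The corner of the value of an nc map at an upper triangular block point. -/
lemma app_blockRow_corner {X B : MatTuple d n} (hX : X ∈ freeBall d n)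
    (h : blockRow X B ∈ freeBall d (n + n)) (j : Fin d) (i k : Fin n) :
    f.app (n + n) (blockRow X B) j (Fin.castAdd n i) (Fin.castAdd n k) = f.app n X j i k := by
  set F : ℝ → ℂ := fun t =>
    f.app (n + n) (blockRow X ((t : ℂ) • B)) j (Fin.castAdd n i) (Fin.castAdd n k)
  have h0 : F 0 = f.app n X j i k := by
    simp only [F, Complex.ofReal_zero, zero_smul, blockRow_zero]
    rw [f.map_dSum X 0 hX zero_mem_freeBall]
    simp [dSum]
  have hcont : ContinuousAt F 0 := by
    have h1 : ContinuousAt (f.app (n + n)) (blockRow X (((0 : ℝ) : ℂ) • B)) :=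
      (f.differentiableAt (blockRow_smul_mem_freeBall h (by simp))).continuousAt
    have h2 : Continuous fun t : ℝ => blockRow X ((t : ℂ) • B) := by
      refine continuous_pi fun j => continuous_matrix fun p q => ?_
      refine Fin.addCases (fun p => ?_) (fun p => ?_) p <;>
      refine Fin.addCases (fun q => ?_) (fun q => ?_) q <;>
        simp [-Fin.natAdd_eq_addNat] <;> fun_prop
    have h3 : Continuous fun Y : MatTuple d (n + n) =>
        Y j (Fin.castAdd n i) (Fin.castAdd n k) :=
      ((continuous_apply j).matrix_elem _ _)
    exact h3.continuousAt.comp (ContinuousAt.comp (f := fun t : ℝ => blockRow X ((t : ℂ) • B)) h1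
      h2.continuousAt)
  have hlim : Filter.Tendsto F (nhdsWithin 0 (Set.Ioi 0)) (nhds (F 0)) :=
    hcont.tendsto.mono_left nhdsWithin_le_nhds
  have hev : ∀ᶠ t in nhdsWithin (0 : ℝ) (Set.Ioi 0), F t =
      f.app (n + n) (blockRow X B) j (Fin.castAdd n i) (Fin.castAdd n k) := by
    filter_upwards [Ioc_mem_nhdsGT (zero_lt_one (α := ℝ))] with t ht
    refine f.app_blockRow_smul_corner h (by exact_mod_cast ht.1.ne') ?_ j i k
    rw [Complex.norm_real, Real.norm_of_nonneg ht.1.le]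
    exact ht.2
  rw [← h0]
  exact tendsto_nhds_unique (tendsto_const_nhds.congr' (hev.mono fun _ h => h.symm)) hlim

/-- Rigidity in the Schwarz lemma, along a direction on which a unit vector is mapped
isometrically. -/
lemma tupleEquiv_app_smul_of_norm_eq_one (hf0 : f.app 1 0 = 0) {Y : MatTuple d n}
    (hY : ‖tupleEquiv d n Y‖ ≤ 1) (hYfix : f.derivZero n Y = Y) {e : EuclideanSpace ℂ (Fin n)}
    (he : ‖e‖ = 1) (hYe : ‖tupleEquiv d n Y e‖ = 1) {z : ℂ} (hz : ‖z‖ < 1) :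
    tupleEquiv d n (f.app n (z • Y)) e = tupleEquiv d n (z • Y) e := by
  have hmem : ∀ z ∈ Metric.ball (0 : ℂ) 1, z • Y ∈ freeBall d n := fun z hz => by
    rw [mem_freeBall_iff_norm_lt_one, map_smul, norm_smul]
    rw [mem_ball_zero_iff] at hz
    nlinarith [norm_nonneg z]
  set ev : MatTuple d n →L[ℂ] EuclideanSpace ℂ (Fin d × Fin n) :=
    (ContinuousLinearMap.apply ℂ _ e) ∘L (tupleEquiv d n : _ →L[ℂ] _) with hev
  have hevY : ∀ X, ev X = tupleEquiv d n X e := fun _ => rfl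
  set φ : ℂ → EuclideanSpace ℂ (Fin d × Fin n) := fun z => ev (f.app n (z • Y)) with hφ
  have hφ0 : φ 0 = 0 := by simp [hφ, f.app_zero hf0]
  have hd : DifferentiableOn ℂ φ (Metric.ball 0 1) :=
    ev.differentiable.comp_differentiableOn ((f.holo n).comp (by fun_prop) hmem)
  have hm : Set.MapsTo φ (Metric.ball 0 1) (Metric.closedBall (φ 0) 1) := fun z hz => by
    rw [hφ0, mem_closedBall_zero_iff]
    refine ((tupleEquiv d n _).le_opNorm e).trans ?_
    rw [he, mul_one]
    exact (mem_freeBall_iff_norm_lt_one.1 (f.mapsTo n (hmem z hz))).le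
  have hderiv : deriv φ 0 = tupleEquiv d n Y e := by
    have h1 : HasDerivAt (fun z : ℂ => z • Y) Y 0 := by
      have := (hasDerivAt_id (0 : ℂ)).smul_const Y
      rw [one_smul] at this
      exact this
    have h2 : HasFDerivAt (f.app n) (f.derivZero n) ((0 : ℂ) • Y) := by
      rw [zero_smul]; exact f.hasFDerivAt_derivZero n
    have h3 := ev.hasFDerivAt.comp_hasDerivAt 0 (h2.comp_hasDerivAt 0 h1)
    exact h3.deriv.trans (congrArg ev hYfix)
  have := Complex.affine_of_mapsTo_ball_of_norm_dslope_eq_div hd hm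
    (Metric.mem_ball_self one_pos) (by rw [dslope_same, hderiv, hYe, div_one])
    (mem_ball_zero_iff.2 hz)
  simp only [hφ0, dslope_same, hderiv, zero_add, sub_zero] at this
  rw [map_smul, _root_.smul_apply]
  exact this

/-- Points fixed by the derivative at the origin are fixed points. -/
lemma app_eq_self_of_derivZero_eq_self (hf0 : f.app 1 0 = 0) {X : MatTuple d n}
    (hX : X ∈ freeBall d n) (hfix : f.derivZero n X = X) : f.app n X = X := by
  rcases eq_or_ne X 0 with rfl | hX0
  · exact f.app_zero hf0 n
  obtain ⟨w, hw, hw1⟩ : ∃ w, f.linPart w = w ∧ ∑ j, ‖w j‖ ^ 2 = 1 := by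
    obtain ⟨p, q, hpq⟩ : ∃ p q, (fun j => X j p q) ≠ 0 := by
      by_contra! h
      exact hX0 (by ext j p q; exact congrFun (h p q) j)
    set u : Fin d → ℂ := fun j => X j p q
    set c : ℝ := ‖WithLp.toLp 2 u‖
    have hc : 0 < c := norm_pos_iff.2 fun h => hpq (congrArg WithLp.ofLp h)
    refine ⟨(c : ℂ)⁻¹ • u, ?_, ?_⟩
    · rw [map_smul, (derivZero_apply_eq_self_iff hf0 X).1 hfix p q]
    · have : c ^ 2 = ∑ j, ‖u j‖ ^ 2 := EuclideanSpace.norm_sq_eq _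
      simp only [Pi.smul_apply, norm_smul, mul_pow, ← Finset.mul_sum, ← this]
      rw [norm_inv, Complex.norm_real, Real.norm_of_nonneg hc.le]
      field_simp
  obtain ⟨r, hr, hr1⟩ := exists_between (mem_freeBall_iff_norm_lt_one.1 hX)
  have hr0 : 0 < r := (norm_nonneg _).trans_lt hr
  have hrc : (r : ℂ) ≠ 0 := by exact_mod_cast hr0.ne'
  have hrn : ‖(r : ℂ)‖ = r := by rw [Complex.norm_real, Real.norm_of_nonneg hr0.le]
  set Z : MatTuple d n := (r : ℂ)⁻¹ • X
  have hZ : Z ∈ freeBall d n := by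
    rw [mem_freeBall_iff_norm_lt_one, map_smul, norm_smul, norm_inv, hrn,
      inv_mul_lt_iff₀ hr0, mul_one]
    exact hr
  have hZX : (r : ℂ) • Z = X := smul_inv_smul₀ hrc X
  have hZfix : f.derivZero n Z = Z := by rw [map_smul, hfix]
  obtain ⟨D, hD⟩ := exists_completion hZ hw1
  set Y := blockRow Z (fun j => w j • D)
  have hYnorm : ∀ ξ : EuclideanSpace ℂ (Fin (n + n)),
      ‖tupleEquiv d (n + n) Y ξ‖ ^ 2 = ∑ i, ‖ξ (Fin.castAdd n i)‖ ^ 2 := fun ξ => by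
    rw [norm_tupleEquiv_apply_sq, sum_norm_vecMul_blockRow_sq, hD]
  have hY1 : ‖tupleEquiv d (n + n) Y‖ ≤ 1 := by
    refine ContinuousLinearMap.opNorm_le_bound _ zero_le_one fun ξ => ?_
    rw [one_mul, ← pow_le_pow_iff_left₀ (norm_nonneg _) (norm_nonneg _) two_ne_zero, hYnorm,
      EuclideanSpace.norm_sq_eq, Fin.sum_univ_add]
    exact le_add_of_nonneg_right (by positivity)
  have hYfix : f.derivZero (n + n) Y = Y := by
    rw [derivZero_apply_eq_self_iff hf0] at hZfix ⊢
    intro p q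
    refine Fin.addCases (fun p => ?_) (fun p => ?_) p
    · refine Fin.addCases (fun q => ?_) (fun q => ?_) q
      · simpa [Y] using hZfix p q
      · have hs : (fun j => Y j (Fin.castAdd n p) (Fin.natAdd n q)) = D p q • w := by
          ext j; simp [Y, mul_comm, -Fin.natAdd_eq_addNat]
        rw [hs, map_smul, hw]
    · have hs : (fun j => Y j (Fin.natAdd n p) q) = 0 := by
        ext j; simp [Y, -Fin.natAdd_eq_addNat]
      rw [hs, map_zero]
  have hrY : (r : ℂ) • Y ∈ freeBall d (n + n) := by
    rw [mem_freeBall_iff_norm_lt_one, map_smul, norm_smul, hrn]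
    nlinarith
  have hrY' : (r : ℂ) • Y = blockRow X ((r : ℂ) • fun j => w j • D) := by
    rw [blockRow_smul, hZX]
  ext j i k
  rw [← f.app_blockRow_corner hX (hrY' ▸ hrY), ← hrY']
  set e : EuclideanSpace ℂ (Fin (n + n)) := EuclideanSpace.single (Fin.castAdd n i) 1
  have hYe : ‖tupleEquiv d (n + n) Y e‖ = 1 := by
    rw [← pow_left_inj₀ (norm_nonneg _) zero_le_one two_ne_zero, hYnorm]
    simp [e, apply_ite norm, ite_pow]
  have := congrFun (congrArg WithLp.ofLp (f.tupleEquiv_app_smul_of_norm_eq_one hf0 hY1 hYfix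
    (e := e) (by simp [e]) hYe (hrn.trans_lt hr1))) (j, Fin.castAdd n k)
  rw [tupleEquiv_apply, tupleEquiv_apply] at this
  simp only [e, PiLp.ofLp_single, Matrix.single_one_vecMul] at this
  rw [Matrix.row_apply, Matrix.row_apply] at this
  rw [this, hrY', blockRow_castAdd_castAdd]

/-- Fixed points are fixed by the derivative at the origin. -/
lemma derivZero_eq_self_of_app_eq_self (hf0 : f.app 1 0 = 0) {X : MatTuple d n}
    (hX : X ∈ freeBall d n) (hfix : f.app n X = X) : f.derivZero n X = X := by
  set e := tupleEquiv d n
  set L := e.toContinuousLinearMap ∘L f.derivZero n ∘L e.symm.toContinuousLinearMap with hL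
  have hmem : ∀ T ∈ Metric.ball 0 1, e.symm T ∈ freeBall d n := fun T hT => by
    rw [mem_freeBall_iff_norm_lt_one]
    simpa [e] using hT
  have h0 : HasFDerivAt (f.app n) (f.derivZero n) (e.symm 0) := by
    rw [map_zero]; exact f.hasFDerivAt_derivZero n
  have := fderiv_apply_eq_self_of_fixed (f := fun T => e (f.app n (e.symm T))) (L := L)
    (x := e X) ?_ ?_ ?_ ?_ ?_ ?_ ?_
  · simpa [hL] using this
  · exact e.differentiable.comp_differentiableOn
      ((f.holo n).comp e.symm.differentiable.differentiableOn hmem)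
  · intro T hT
    rw [mem_ball_zero_iff]
    exact mem_freeBall_iff_norm_lt_one.1 (f.mapsTo n (hmem T hT))
  · simp [f.app_zero hf0]
  · exact e.hasFDerivAt.comp 0 (h0.comp 0 e.symm.hasFDerivAt)
  · intro T hT hLT
    have h1 : f.derivZero n (e.symm T) = e.symm T := by
      rw [ContinuousLinearEquiv.eq_symm_apply]
      exact hLT
    simp [f.app_eq_self_of_derivZero_eq_self hf0 (hmem T hT) h1]
  · rw [mem_ball_zero_iff]
    exact mem_freeBall_iff_norm_lt_one.1 hX
  · simp [hfix]

lemma app_eq_self_iff (hf0 : f.app 1 0 = 0) {X : MatTuple d n} (hX : X ∈ freeBall d n) :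
    f.app n X = X ↔ ∀ k l, f.linPart (fun j => X j k l) = fun j => X j k l := by
  rw [← derivZero_apply_eq_self_iff hf0]
  exact ⟨f.derivZero_eq_self_of_app_eq_self hf0 hX, f.app_eq_self_of_derivZero_eq_self hf0 hX⟩

end NCSelfMap

end BlockRow

/-- Membership in a subspace of `ℂ^d` is detected by the linear relations of the subspace. -/
lemma mem_submodule_iff_forall_relation {d : ℕ} (V : Submodule ℂ (Fin d → ℂ)) (u : Fin d → ℂ) :
    u ∈ V ↔ ∀ α : Fin d → ℂ, (∀ v ∈ V, ∑ j, α j * v j = 0) → ∑ j, α j * u j = 0 := by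
  refine ⟨fun hu α hα => hα u hu, fun h => ?_⟩
  by_contra hu
  obtain ⟨φ, hφu, hφ⟩ := Submodule.exists_le_ker_of_notMem hu
  have hrep : ∀ v, ∑ j, φ (Pi.single j 1) * v j = φ v := fun v => by
    conv_rhs => rw [← Finset.univ_sum_single v, map_sum]
    refine Finset.sum_congr rfl fun j _ => ?_
    rw [← mul_one (v j), ← smul_eq_mul (v j), Pi.single_smul, map_smul, smul_eq_mul, smul_eq_mul]
    ring
  refine hφu ?_
  rw [← hrep]
  exact h _ fun v hv => by rw [hrep]; exact hφ hv

/-- if the level-1 fixed point set of an nc self-map fixing the origin is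
exactly `V₁ ∩ 𝔅_d(1)` for a linear subspace `V₁ ⊆ ℂ^d`, then the fixed point set on
level `n` is exactly the set of points whose coordinates satisfy all homogeneous linear
relations of `V₁`. -/
theorem stmt_16 {d : ℕ} (f : NCSelfMap d) (hf0 : f.app 1 0 = 0)
    (V₁ : Submodule ℂ (Fin d → ℂ))
    (hfix1 : ∀ v : Fin d → ℂ, scalarPt d 1 v ∈ freeBall d 1 →
      (f.app 1 (scalarPt d 1 v) = scalarPt d 1 v ↔ v ∈ V₁)) :
    ∀ n : ℕ, 1 ≤ n → ∀ X ∈ freeBall d n,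
      (f.app n X = X ↔
        ∀ α : Fin d → ℂ, (∀ v ∈ V₁, ∑ j, α j * v j = 0) → ∑ j, α j • X j = 0) := by
  have hV : ∀ v : Fin d → ℂ, f.linPart v = v ↔ v ∈ V₁ := fun v => by
    obtain ⟨t, ht0, ht⟩ := exists_smul_mem_freeBall (scalarPt d 1 v)
    have hts : t • scalarPt d 1 v = scalarPt d 1 (t • v) := by
      ext j : 1; simp [scalarPt, mul_smul]
    rw [hts] at ht
    have hent : ∀ k l : Fin 1, (fun j => scalarPt d 1 (t • v) j k l) = t • v := fun k l => by
      ext j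
      rw [Subsingleton.elim k l]
      simp [scalarPt]
    have h := hfix1 _ ht
    simp only [f.app_eq_self_iff hf0 ht, hent, map_smul, forall_const,
      smul_right_injective _ ht0 |>.eq_iff] at h
    rw [h, Submodule.smul_mem_iff _ ht0]
  intro n _ X hX
  rw [f.app_eq_self_iff hf0 hX]
  simp only [hV]
  rw [forall_congr' fun k => forall_congr' fun l =>
    mem_submodule_iff_forall_relation V₁ (fun j => X j k l)]
  refine ⟨fun h α hα => ?_, fun h k l α hα => ?_⟩
  · ext k l
    simpa [Matrix.sum_apply] using h k l α hα
  · simpa [Matrix.sum_apply] using congrFun (congrFun (h α hα) k) l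
end

section
/- Let f be an nc self-map of 𝔅_d with f₁(0) = 0, and suppose that for some n the fixed-point set F = {X ∈ 𝔅_d(n) : f_n(X) = X} satisfies no common homogeneous linear relation: for every nonzero α ∈ ℂ^d there exists X ∈ F with Σ_{j=1}^d α_j X_j ≠ 0. Then f is the identity map: f_m(Z) = Z for every m ≥ 1 and every Z ∈ 𝔅_d(m). -/
open Matrix
open scoped ComplexOrder

attribute [local instance] Matrix.normedAddCommGroup Matrix.normedSpace

section RowOperators

variable {d : ℕ} {ι κ : Type*} [Fintype ι] [Fintype κ]

/-- The map `a ↦ (a X_1, …, a X_d)` on row vectors induced by a tuple of matrices. -/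
noncomputable def rowOp (X : Fin d → Matrix ι ι ℂ) :
    EuclideanSpace ℂ ι →L[ℂ] EuclideanSpace ℂ (Fin d × ι) :=
  LinearMap.toContinuousLinearMap
    { toFun := fun a => WithLp.toLp 2 fun p => ∑ i, a i * X p.1 i p.2
      map_add' := fun a b => by
        ext p
        simp [add_mul, Finset.sum_add_distrib]
      map_smul' := fun c a => by
        ext p
        simp [Finset.mul_sum, mul_assoc] }

@[simp]
theorem rowOp_apply (X : Fin d → Matrix ι ι ℂ) (a : EuclideanSpace ℂ ι) (p : Fin d × ι) :
    rowOp X a p = ∑ i, a i * X p.1 i p.2 := rfl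

/-- Strict row contractions, for matrices indexed by an arbitrary finite type. -/
def StrictRow (X : Fin d → Matrix ι ι ℂ) : Prop :=
  ∀ a : EuclideanSpace ℂ ι, a ≠ 0 → ‖rowOp X a‖ < ‖a‖

theorem StrictRow.norm_le {X : Fin d → Matrix ι ι ℂ} (hX : StrictRow X)
    (a : EuclideanSpace ℂ ι) : ‖rowOp X a‖ ≤ ‖a‖ := by
  rcases eq_or_ne a 0 with rfl | ha
  · simp
  · exact (hX a ha).le

@[simp]
theorem rowOp_zero : rowOp (0 : Fin d → Matrix ι ι ℂ) = 0 := by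
  ext a p
  simp

theorem strictRow_zero : StrictRow (0 : Fin d → Matrix ι ι ℂ) := fun a ha => by
  simpa using norm_pos_iff.2 ha

theorem norm_rowOp_sq (X : Fin d → Matrix ι ι ℂ) (a : EuclideanSpace ℂ ι) :
    ‖rowOp X a‖ ^ 2 = ∑ j, ∑ k, ‖∑ i, a i * X j i k‖ ^ 2 := by
  rw [EuclideanSpace.norm_sq_eq, Fintype.sum_prod_type]
  rfl

theorem star_dotProduct_one_sub_mulVec [DecidableEq ι] (X : Fin d → Matrix ι ι ℂ)
    (a : EuclideanSpace ℂ ι) :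
    star (star a.ofLp) ⬝ᵥ ((1 - ∑ j, X j * (X j)ᴴ) *ᵥ star a.ofLp) =
      ((‖a‖ ^ 2 - ‖rowOp X a‖ ^ 2 : ℝ) : ℂ) := by
  have key : ∀ v : ι → ℂ, v ⬝ᵥ star v = ((∑ k, ‖v k‖ ^ 2 : ℝ) : ℂ) := by
    intro v
    simp [dotProduct, Complex.mul_conj, Complex.normSq_eq_norm_sq]
  rw [norm_rowOp_sq, EuclideanSpace.norm_sq_eq, Matrix.sub_mulVec, dotProduct_sub, star_star,
    Matrix.one_mulVec, key, Complex.ofReal_sub, Matrix.sum_mulVec, dotProduct_sum]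
  congr 1
  rw [Complex.ofReal_sum]
  refine Finset.sum_congr rfl fun j _ => ?_
  rw [← Matrix.mulVec_mulVec, Matrix.dotProduct_mulVec, ← Matrix.star_vecMul, key]
  rfl

theorem mem_freeBall_iff_s17 {n : ℕ} (X : MatTuple d n) : X ∈ freeBall d n ↔ StrictRow X := by
  unfold freeBall StrictRow
  rw [Set.mem_ofPred_eq, Matrix.posDef_iff_dotProduct_mulVec]
  constructor
  · rintro ⟨-, h⟩ a ha
    have := h (x := star a.ofLp) (by simpa using ha)
    rw [star_dotProduct_one_sub_mulVec] at this
    have h2 := Complex.zero_lt_real.1 this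
    exact lt_of_pow_lt_pow_left₀ 2 (norm_nonneg _) (by linarith)
  · intro h
    refine ⟨?_, fun x hx => ?_⟩
    · rw [Matrix.IsHermitian]
      simp [Matrix.conjTranspose_sum]
    · have := h (WithLp.toLp 2 (star x)) (by simpa using hx)
      have h3 := star_dotProduct_one_sub_mulVec X (WithLp.toLp 2 (star x))
      simp only [star_star] at h3
      rw [h3]
      refine Complex.zero_lt_real.2 ?_
      have := pow_lt_pow_left₀ this (norm_nonneg _) two_ne_zero
      linarith

theorem StrictRow.submatrix {X : Fin d → Matrix ι ι ℂ} (hX : StrictRow X) (e : κ ≃ ι) :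
    StrictRow fun j => (X j).submatrix e e := by
  intro a ha
  have h := hX (WithLp.toLp 2 (a.ofLp ∘ e.symm)) (by
    intro h0
    apply ha
    ext i
    have := congrArg (fun v : EuclideanSpace ℂ ι => v (e i)) h0
    simpa using this)
  have h1 : ‖rowOp (fun j => (X j).submatrix e e) a‖ =
      ‖rowOp X (WithLp.toLp 2 (a.ofLp ∘ e.symm))‖ := by
    rw [← sq_eq_sq₀ (norm_nonneg _) (norm_nonneg _), norm_rowOp_sq, norm_rowOp_sq]
    refine Finset.sum_congr rfl fun j _ => ?_
    rw [← e.sum_comp]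
    refine Finset.sum_congr rfl fun k _ => ?_
    congr 2
    conv_rhs => rw [← e.sum_comp]
    simp
  have h2 : ‖(WithLp.toLp 2 (a.ofLp ∘ e.symm) : EuclideanSpace ℂ ι)‖ = ‖a‖ := by
    rw [← sq_eq_sq₀ (norm_nonneg _) (norm_nonneg _), EuclideanSpace.norm_sq_eq,
      EuclideanSpace.norm_sq_eq, ← e.sum_comp]
    simp
  rwa [h1, ← h2]

theorem StrictRow.fromBlocks_diagonal {X : Fin d → Matrix ι ι ℂ} {Y : Fin d → Matrix κ κ ℂ}
    (hX : StrictRow X) (hY : StrictRow Y) :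
    StrictRow fun j => Matrix.fromBlocks (X j) 0 0 (Y j) := by
  intro a ha
  set b : EuclideanSpace ℂ ι := WithLp.toLp 2 fun i => a (Sum.inl i) with hb
  set c : EuclideanSpace ℂ κ := WithLp.toLp 2 fun i => a (Sum.inr i) with hc
  have h1 : ‖rowOp (fun j => Matrix.fromBlocks (X j) 0 0 (Y j)) a‖ ^ 2 =
      ‖rowOp X b‖ ^ 2 + ‖rowOp Y c‖ ^ 2 := by
    simp [norm_rowOp_sq, Fintype.sum_sum_type, Finset.sum_add_distrib, hb, hc]
  have h2 : ‖a‖ ^ 2 = ‖b‖ ^ 2 + ‖c‖ ^ 2 := by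
    simp [EuclideanSpace.norm_sq_eq, Fintype.sum_sum_type, hb, hc]
  refine lt_of_pow_lt_pow_left₀ 2 (norm_nonneg _) ?_
  rw [h1, h2]
  by_cases hb0 : b = 0
  · have hc0 : c ≠ 0 := by
      intro hc0
      have : ‖a‖ ^ 2 = 0 := by rw [h2, hb0, hc0]; simp
      exact ha (by simpa using this)
    exact add_lt_add_of_le_of_lt (pow_le_pow_left₀ (norm_nonneg _) (hX.norm_le b) 2)
      (pow_lt_pow_left₀ (hY c hc0) (norm_nonneg _) two_ne_zero)
  · exact add_lt_add_of_lt_of_le (pow_lt_pow_left₀ (hX b hb0) (norm_nonneg _) two_ne_zero)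
      (pow_le_pow_left₀ (norm_nonneg _) (hY.norm_le c) 2)

/-- A strict row contraction contracts by a uniform factor. -/
theorem StrictRow.exists_uniform {X : Fin d → Matrix ι ι ℂ} (hX : StrictRow X) :
    ∃ c : ℝ, 0 ≤ c ∧ c < 1 ∧ ∀ a, ‖rowOp X a‖ ≤ c * ‖a‖ := by
  rcases isEmpty_or_nonempty ι with hι | hι
  · refine ⟨0, le_rfl, one_pos, fun a => ?_⟩
    rw [Subsingleton.elim a 0]
    simp
  · obtain ⟨u, hu, hmax⟩ := (isCompact_sphere (0 : EuclideanSpace ℂ ι) 1).exists_isMaxOn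
      (NormedSpace.sphere_nonempty.2 zero_le_one) (rowOp X).continuous.norm.continuousOn
    have hu1 : ‖u‖ = 1 := by simpa using hu
    refine ⟨‖rowOp X u‖, norm_nonneg _, ?_, fun a => ?_⟩
    · rw [← hu1]
      exact hX u (by rintro rfl; simp at hu1)
    · rcases eq_or_ne a 0 with rfl | ha
      · simp
      have ha' : ‖a‖ ≠ 0 := norm_ne_zero_iff.2 ha
      have h := hmax (show ((‖a‖⁻¹ : ℝ) : ℂ) • a ∈ Metric.sphere (0 : EuclideanSpace ℂ ι) 1 by
        simp [norm_smul, ha'])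
      simp only [Set.mem_ofPred_eq, map_smul, norm_smul] at h
      simp only [Complex.norm_real, norm_inv, norm_norm] at h
      rwa [inv_mul_le_iff₀ (by positivity), mul_comm] at h

end RowOperators

section Dilation

open scoped InnerProductSpace

variable {E F : Type*} [NormedAddCommGroup E] [InnerProductSpace ℂ E] [CompleteSpace E]
  [NormedAddCommGroup F] [InnerProductSpace ℂ F] [CompleteSpace F]

/-- Every vector `H` in the target of a strict contraction `R` lies in the range of a strict
contraction `[R D]` extending `R` by one dimension, with a preimage hardly longer than `H`. -/
theorem exists_strict_extension (R : E →L[ℂ] F) (hR : ∀ a, a ≠ 0 → ‖R a‖ < ‖a‖) (H : F)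
    {s : ℝ} (hs0 : 0 < s) (hs1 : s < 1) :
    ∃ (D : F) (r : E) (t : ℂ), R r + t • D = H ∧
      s ^ 2 * (‖r‖ ^ 2 + ‖t‖ ^ 2) ≤ ‖H‖ ^ 2 ∧
      ∀ a : E, ∀ b : ℂ, (a ≠ 0 ∨ b ≠ 0) → ‖R a + b • D‖ ^ 2 < ‖a‖ ^ 2 + ‖b‖ ^ 2 := by
  have hRle : ∀ a, ‖R a‖ ≤ ‖a‖ := fun a => by
    rcases eq_or_ne a 0 with rfl | ha
    · simp
    · exact (hR a ha).le
  rcases eq_or_ne H 0 with rfl | hH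
  · refine ⟨0, 0, 0, by simp, by simp, fun a b hab => ?_⟩
    rcases eq_or_ne a 0 with rfl | ha
    · have hb : b ≠ 0 := by simpa using hab
      have : 0 < ‖b‖ := norm_pos_iff.2 hb
      simp only [map_zero, smul_zero, add_zero, norm_zero]
      nlinarith
    · have := pow_lt_pow_left₀ (hR a ha) (norm_nonneg _) two_ne_zero
      simp only [smul_zero, add_zero]
      nlinarith [sq_nonneg ‖b‖]
  set r : E := ContinuousLinearMap.adjoint R H with hr
  have hrH : ‖r‖ < ‖H‖ := by
    rcases eq_or_ne r 0 with h0 | h0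
    · rw [h0, norm_zero]
      exact norm_pos_iff.2 hH
    · have h1 : ‖r‖ ^ 2 ≤ ‖R r‖ * ‖H‖ := by
        have : ⟪R r, H⟫_ℂ = ⟪r, r⟫_ℂ := by rw [hr, ContinuousLinearMap.adjoint_inner_right]
        have h2 := norm_inner_le_norm (𝕜 := ℂ) (R r) H
        rw [this, inner_self_eq_norm_sq_to_K] at h2
        simpa using h2
      have h3 := hR r h0
      have h4 := norm_pos_iff.2 h0
      have h5 := norm_pos_iff.2 hH
      nlinarith
  set δ : ℝ := √(‖H‖ ^ 2 - ‖r‖ ^ 2) with hδ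
  have hpos : 0 < ‖H‖ ^ 2 - ‖r‖ ^ 2 := by nlinarith [norm_nonneg r]
  have hδ0 : 0 < δ := Real.sqrt_pos.2 hpos
  have hδ2 : δ ^ 2 = ‖H‖ ^ 2 - ‖r‖ ^ 2 := Real.sq_sqrt hpos.le
  have hδc : (δ : ℂ) ≠ 0 := by exact_mod_cast hδ0.ne'
  have hsc : (s : ℂ) ≠ 0 := by exact_mod_cast hs0.ne'
  set D₀ : F := (δ : ℂ)⁻¹ • (H - R r) with hD₀
  have contr : ∀ a : E, ∀ b : ℂ, ‖R a + b • D₀‖ ^ 2 ≤ ‖a‖ ^ 2 + ‖b‖ ^ 2 := by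
    intro a b
    set l : ℂ := b * (δ : ℂ)⁻¹ with hl
    set a' : E := a - l • r with ha'
    have e1 : R a + b • D₀ = l • H + R a' := by
      rw [ha', hD₀, map_sub, map_smul, smul_smul, smul_sub]
      abel
    have e2 : a = l • r + a' := by rw [ha']; abel
    have e3 : ⟪l • H, R a'⟫_ℂ = ⟪l • r, a'⟫_ℂ := by
      rw [inner_smul_left, inner_smul_left, hr, ContinuousLinearMap.adjoint_inner_left]
    have e4 : ‖b‖ = ‖l‖ * δ := by
      rw [hl, norm_mul, norm_inv, Complex.norm_real, Real.norm_of_nonneg hδ0.le]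
      field_simp
    rw [e1, e4]
    conv_rhs => rw [e2]
    rw [norm_add_sq (𝕜 := ℂ), norm_add_sq (𝕜 := ℂ), e3, norm_smul, norm_smul, mul_pow, mul_pow,
      mul_pow, hδ2]
    have := pow_le_pow_left₀ (norm_nonneg _) (hRle a') 2
    nlinarith
  refine ⟨(s : ℂ) • D₀, r, (δ : ℂ) * (s : ℂ)⁻¹, ?_, ?_, ?_⟩
  · rw [smul_smul, mul_assoc, inv_mul_cancel₀ hsc, mul_one, hD₀, smul_smul, mul_inv_cancel₀ hδc,
      one_smul]
    abel
  · rw [norm_mul, norm_inv, Complex.norm_real, Complex.norm_real, Real.norm_of_nonneg hδ0.le,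
      Real.norm_of_nonneg hs0.le, mul_pow, hδ2]
    have : s ^ 2 * (‖r‖ ^ 2 + (‖H‖ ^ 2 - ‖r‖ ^ 2) * s⁻¹ ^ 2) =
        s ^ 2 * ‖r‖ ^ 2 + (‖H‖ ^ 2 - ‖r‖ ^ 2) := by
      field_simp
    rw [this]
    nlinarith [sq_nonneg ‖r‖, mul_nonneg (sq_nonneg ‖r‖) (by nlinarith : 0 ≤ 1 - s ^ 2)]
  · intro a b hab
    by_cases hb : b = 0
    · have ha : a ≠ 0 := by simpa [hb] using hab
      simpa [hb] using pow_lt_pow_left₀ (hR a ha) (norm_nonneg _) two_ne_zero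
    · have h := contr a (b * s)
      rw [smul_smul]
      refine h.trans_lt ?_
      rw [norm_mul, mul_pow, Complex.norm_real, Real.norm_of_nonneg hs0.le]
      have : 0 < ‖b‖ ^ 2 := by positivity
      have hs : s ^ 2 < 1 := pow_lt_one₀ hs0.le hs1 two_ne_zero
      nlinarith

end Dilation

namespace NCSelfMap

section Transport

variable {d : ℕ} (f : NCSelfMap d) {ι κ : Type*} [Fintype ι] [Fintype κ]

theorem dSum_mem_freeBall {n m : ℕ} {X : MatTuple d n} {Y : MatTuple d m}
    (hX : X ∈ freeBall d n) (hY : Y ∈ freeBall d m) : dSum X Y ∈ freeBall d (n + m) := by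
  rw [mem_freeBall_iff_s17] at *
  exact (hX.fromBlocks_diagonal hY).submatrix finSumFinEquiv.symm

/-- nc maps respect intertwinings. -/
theorem app_intertwine {n m : ℕ} {X : MatTuple d n} {Y : MatTuple d m}
    (hX : X ∈ freeBall d n) (hY : Y ∈ freeBall d m) (Γ : Matrix (Fin n) (Fin m) ℂ)
    (h : ∀ j, X j * Γ = Γ * Y j) (j : Fin d) : f.app n X j * Γ = Γ * f.app m Y j := by
  set S₀ : Matrix (Fin n ⊕ Fin m) (Fin n ⊕ Fin m) ℂ := Matrix.fromBlocks 1 Γ 0 1 with hS₀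
  set S : Matrix (Fin (n + m)) (Fin (n + m)) ℂ :=
    S₀.submatrix finSumFinEquiv.symm finSumFinEquiv.symm with hS
  have hSu : IsUnit S := by
    rw [Matrix.isUnit_iff_isUnit_det, hS, Matrix.det_submatrix_equiv_self, hS₀,
      Matrix.det_fromBlocks_zero₂₁]
    simp
  have hSd : IsUnit S.det := (Matrix.isUnit_iff_isUnit_det _).1 hSu
  have hcomm : (fun j => S⁻¹ * dSum X Y j * S) = dSum X Y := by
    funext j
    have : dSum X Y j * S = S * dSum X Y j := by
      simp only [dSum, Matrix.reindex_apply, hS, Matrix.submatrix_mul_equiv, hS₀,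
        Matrix.fromBlocks_multiply]
      simp [h j]
    rw [mul_assoc, this, Matrix.nonsing_inv_mul_cancel_left _ _ hSd]
  have hD := dSum_mem_freeBall hX hY
  have hsim := congrFun (f.map_sim (dSum X Y) S hD hSu (by rwa [hcomm])) j
  rw [hcomm, f.map_dSum X Y hX hY] at hsim
  have hsim' : S * dSum (f.app n X) (f.app m Y) j = dSum (f.app n X) (f.app m Y) j * S := by
    conv_lhs => rw [hsim]
    rw [mul_assoc, Matrix.mul_nonsing_inv_cancel_left _ _ hSd]
  simp only [dSum, Matrix.reindex_apply, hS, Matrix.submatrix_mul_equiv, hS₀,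
    Matrix.fromBlocks_multiply] at hsim'
  have := congrFun₂ (congrArg Matrix.of.symm hsim')
  ext i k
  have h' := this (finSumFinEquiv (Sum.inl i)) (finSumFinEquiv (Sum.inr k))
  simpa using h'.symm

/-- The action of an nc self-map on matrices indexed by an arbitrary finite type. -/
noncomputable def onType (X : Fin d → Matrix ι ι ℂ) : Fin d → Matrix ι ι ℂ := fun j =>
  (f.app (Fintype.card ι)
    (fun j => (X j).submatrix (Fintype.equivFin ι).symm (Fintype.equivFin ι).symm) j).submatrix
      (Fintype.equivFin ι) (Fintype.equivFin ι)

theorem onType_strictRow {X : Fin d → Matrix ι ι ℂ} (hX : StrictRow X) :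
    StrictRow (f.onType X) :=
  ((mem_freeBall_iff_s17 _).1 (f.mapsTo _ ((mem_freeBall_iff_s17 _).2
    (hX.submatrix (Fintype.equivFin ι).symm)))).submatrix (Fintype.equivFin ι)

theorem onType_intertwine {X : Fin d → Matrix ι ι ℂ} {Y : Fin d → Matrix κ κ ℂ}
    (hX : StrictRow X) (hY : StrictRow Y) (Γ : Matrix ι κ ℂ)
    (h : ∀ j, X j * Γ = Γ * Y j) (j : Fin d) : f.onType X j * Γ = Γ * f.onType Y j := by
  have := f.app_intertwine ((mem_freeBall_iff_s17 _).2 (hX.submatrix (Fintype.equivFin ι).symm))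
    ((mem_freeBall_iff_s17 _).2 (hY.submatrix (Fintype.equivFin κ).symm))
    (Γ.submatrix (Fintype.equivFin ι).symm (Fintype.equivFin κ).symm)
    (fun j => by simp only [Matrix.submatrix_mul_equiv, h j]) j
  have h2 := congrArg (fun M => M.submatrix (Fintype.equivFin ι) (Fintype.equivFin κ)) this
  rw [← Matrix.submatrix_mul_equiv _ _ _ (Fintype.equivFin ι),
    ← Matrix.submatrix_mul_equiv _ _ _ (Fintype.equivFin κ)] at h2
  simpa [onType] using h2

theorem onType_fin {n : ℕ} {X : MatTuple d n} (hX : X ∈ freeBall d n) :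
    f.onType X = f.app n X := by
  funext j
  have hX' := (mem_freeBall_iff_s17 _).1 hX
  set e := Fintype.equivFin (Fin n)
  have := f.app_intertwine (X := fun j => (X j).submatrix e.symm e.symm) (Y := X)
    ((mem_freeBall_iff_s17 _).2 (hX'.submatrix e.symm)) hX
    ((1 : Matrix (Fin n) (Fin n) ℂ).submatrix e.symm id)
    (fun j => by
      rw [Matrix.submatrix_mul_equiv]
      ext i k
      simp [Matrix.mul_apply, Matrix.one_apply]) j
  ext i k
  have h2 := congrFun₂ (congrArg Matrix.of.symm this) (e i) k
  have hk : ∀ M : Matrix (Fin (Fintype.card (Fin n))) (Fin (Fintype.card (Fin n))) ℂ,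
      (M * (1 : Matrix (Fin n) (Fin n) ℂ).submatrix e.symm id) (e i) k = M (e i) (e k) := by
    intro M
    rw [Matrix.mul_apply, Finset.sum_eq_single (e k)]
    · rw [Matrix.submatrix_apply, Equiv.symm_apply_apply, id, Matrix.one_apply_eq, mul_one]
    · intro b _ hb
      have : e.symm b ≠ k := fun h => hb (by rw [← h, Equiv.apply_symm_apply])
      rw [Matrix.submatrix_apply, id, Matrix.one_apply_ne this, mul_zero]
    · simp
  have h3 : ((1 : Matrix (Fin n) (Fin n) ℂ).submatrix e.symm id * f.app n X j) (e i) k =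
      f.app n X j i k := by
    simp [Matrix.mul_apply, Matrix.one_apply]
  simp only [Matrix.of_symm_apply] at h2
  rw [hk, h3] at h2
  exact h2

theorem onType_punit (hf0 : f.app 1 0 = 0) : f.onType (0 : Fin d → Matrix Unit Unit ℂ) = 0 := by
  funext j
  have h := f.onType_intertwine (strictRow_zero (ι := Unit)) (strictRow_zero (ι := Fin 1))
    (Matrix.of fun _ _ => 1)
    (fun j => by simp) j
  rw [f.onType_fin ((mem_freeBall_iff_s17 _).2 strictRow_zero), hf0] at h
  ext ⟨⟩ ⟨⟩
  have h2 := congrFun₂ (congrArg Matrix.of.symm h) () 0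
  simpa [Matrix.mul_apply] using h2

theorem differentiableOn_onType_comp {X : ℂ → Fin d → Matrix ι ι ℂ} {U : Set ℂ}
    (hX : ∀ j i k, DifferentiableOn ℂ (fun z => X z j i k) U) (hU : ∀ z ∈ U, StrictRow (X z))
    (j : Fin d) (i k : ι) : DifferentiableOn ℂ (fun z => f.onType (X z) j i k) U := by
  set e := Fintype.equivFin ι
  have h1 : DifferentiableOn ℂ (fun z => (fun j => (X z j).submatrix e.symm e.symm :
      MatTuple d (Fintype.card ι))) U := by
    refine differentiableOn_pi.2 fun j => ?_
    refine differentiableOn_pi.2 fun i => ?_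
    exact differentiableOn_pi.2 fun k => hX j _ _
  have h2 := (f.holo _).comp h1 fun z hz => (mem_freeBall_iff_s17 _).2 ((hU z hz).submatrix e.symm)
  have h3 := differentiableOn_pi.1 (differentiableOn_pi.1 (differentiableOn_pi.1 h2 j) (e i)) (e k)
  exact h3

end Transport

section Corner

variable {d : ℕ} {ι κ : Type*} [Fintype ι] [Fintype κ]

/-- The tuple of block matrices `[0 H; 0 X]` with `H` a tuple of row vectors. -/
def rowExtension (H : EuclideanSpace ℂ (Fin d × κ)) (X : Fin d → Matrix κ κ ℂ) :
    Fin d → Matrix (Unit ⊕ κ) (Unit ⊕ κ) ℂ :=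
  fun j => Matrix.fromBlocks 0 (Matrix.of fun _ k => H (j, k)) 0 (X j)

theorem strictRow_rowExtension {X : Fin d → Matrix κ κ ℂ} {c : ℝ}
    (hX : ∀ a, ‖rowOp X a‖ ≤ c * ‖a‖) {H : EuclideanSpace ℂ (Fin d × κ)}
    (hc : c ^ 2 + ‖H‖ ^ 2 < 1) : StrictRow (rowExtension H X) := by
  intro a ha
  set b : ℂ := a (Sum.inl ()) with hb
  set a' : EuclideanSpace ℂ κ := WithLp.toLp 2 fun k => a (Sum.inr k) with ha'
  have h1 : ‖rowOp (rowExtension H X) a‖ ^ 2 = ‖b • H + rowOp X a'‖ ^ 2 := by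
    rw [norm_rowOp_sq, EuclideanSpace.norm_sq_eq, Fintype.sum_prod_type]
    simp [rowExtension, Fintype.sum_sum_type, hb, ha']
  have h2 : ‖a‖ ^ 2 = ‖b‖ ^ 2 + ‖a'‖ ^ 2 := by
    simp [EuclideanSpace.norm_sq_eq, Fintype.sum_sum_type, hb, ha']
  have h3 : ‖b • H + rowOp X a'‖ ≤ ‖b‖ * ‖H‖ + c * ‖a'‖ :=
    (norm_add_le _ _).trans (add_le_add (norm_smul b H).le (hX a'))
  have h4 : 0 < ‖a‖ ^ 2 := by
    have := norm_pos_iff.2 ha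
    positivity
  refine lt_of_pow_lt_pow_left₀ 2 (norm_nonneg _) ?_
  rw [h1]
  refine (pow_le_pow_left₀ (norm_nonneg _) h3 2).trans_lt ?_
  have h5 : (‖b‖ * ‖H‖ + c * ‖a'‖) ^ 2 ≤ ‖a‖ ^ 2 * (c ^ 2 + ‖H‖ ^ 2) := by
    rw [h2]
    nlinarith [sq_nonneg (‖b‖ * c - ‖H‖ * ‖a'‖)]
  nlinarith

theorem strictRow_rowExtension_zero {H : EuclideanSpace ℂ (Fin d × κ)} (hH : ‖H‖ < 1) :
    StrictRow (rowExtension H 0) := by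
  refine strictRow_rowExtension (c := 0) (fun a => ?_) (by nlinarith [norm_nonneg H])
  simp

variable (f : NCSelfMap d)

/-- The upper right corner of the value of an nc map at `[0 H; 0 X]`. -/
noncomputable def corner (H : EuclideanSpace ℂ (Fin d × κ)) (X : Fin d → Matrix κ κ ℂ) :
    EuclideanSpace ℂ (Fin d × κ) :=
  WithLp.toLp 2 fun p => f.onType (rowExtension H X) p.1 (Sum.inl ()) (Sum.inr p.2)

variable {f}

theorem onType_rowExtension_inl (hf0 : f.app 1 0 = 0) {H : EuclideanSpace ℂ (Fin d × κ)}
    {X : Fin d → Matrix κ κ ℂ} (hHX : StrictRow (rowExtension H X)) (j : Fin d)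
    (i : Unit ⊕ κ) : f.onType (rowExtension H X) j i (Sum.inl ()) = 0 := by
  have h := f.onType_intertwine hHX (strictRow_zero (ι := Unit))
    (Matrix.of fun i _ => Sum.elim (fun _ => 1) (fun _ => 0) i) (fun j => by
      ext i k
      rcases i with i | i <;>
      simp [rowExtension, Matrix.mul_apply, Fintype.sum_sum_type]) j
  rw [f.onType_punit hf0] at h
  have h2 := congrFun₂ (congrArg Matrix.of.symm h) i ()
  simpa [Matrix.mul_apply, Fintype.sum_sum_type] using h2

theorem corner_intertwine {H : EuclideanSpace ℂ (Fin d × ι)} {X : Fin d → Matrix ι ι ℂ}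
    {H' : EuclideanSpace ℂ (Fin d × κ)} {X' : Fin d → Matrix κ κ ℂ}
    (hHX : StrictRow (rowExtension H X)) (hHX' : StrictRow (rowExtension H' X'))
    (C : Matrix ι κ ℂ) (hC : ∀ j, X j * C = C * X' j)
    (hH : ∀ j l, H' (j, l) = ∑ k, H (j, k) * C k l) (j : Fin d) (l : κ) :
    corner f H' X' (j, l) = ∑ k, corner f H X (j, k) * C k l := by
  have h := f.onType_intertwine hHX hHX' (Matrix.fromBlocks 1 0 0 C) (fun j => by
    simp only [rowExtension, Matrix.fromBlocks_multiply]
    congr 1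
    · simp
    · ext i k
      simp [hH, Matrix.mul_apply]
    · simp
    · simpa using hC j) j
  have h2 := congrFun₂ (congrArg Matrix.of.symm h) (Sum.inl ()) (Sum.inr l)
  simpa [Matrix.mul_apply, Fintype.sum_sum_type, corner, eq_comm] using h2

theorem corner_rowOp (hf0 : f.app 1 0 = 0) {X : Fin d → Matrix κ κ ℂ} (hX : StrictRow X)
    (a : EuclideanSpace ℂ κ) (hHX : StrictRow (rowExtension (rowOp X a) X)) :
    corner f (rowOp X a) X = rowOp (f.onType X) a := by
  classical
  ext ⟨j, l⟩
  have h := f.onType_intertwine hHX hX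
    (Matrix.of fun i k => Sum.elim (fun _ => a k) (fun i => if i = k then 1 else 0) i)
    (fun j => by
      ext i k
      rcases i with i | i <;>
      simp [rowExtension, Matrix.mul_apply, Fintype.sum_sum_type]) j
  have h2 := congrFun₂ (congrArg Matrix.of.symm h) (Sum.inl ()) l
  simpa [Matrix.mul_apply, Fintype.sum_sum_type, corner,
    onType_rowExtension_inl hf0 hHX] using h2

theorem norm_corner_le (hf0 : f.app 1 0 = 0) {H : EuclideanSpace ℂ (Fin d × κ)}
    {X : Fin d → Matrix κ κ ℂ} (hX : StrictRow X) (hHX : StrictRow (rowExtension H X)) :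
    ‖corner f H X‖ ≤ ‖H‖ := by
  classical
  have key : ∀ s : ℝ, 0 < s → s < 1 → s * ‖corner f H X‖ ≤ ‖H‖ := by
    intro s hs0 hs1
    obtain ⟨D, r, t, hrt, hnorm, hD⟩ := exists_strict_extension (rowOp X) hX H hs0 hs1
    set Y : Fin d → Matrix (κ ⊕ Unit) (κ ⊕ Unit) ℂ := fun j =>
      Matrix.fromBlocks (X j) 0 (Matrix.of fun _ k => D (j, k)) 0 with hY
    have rowY : ∀ (a : EuclideanSpace ℂ κ) (b : ℂ) (a' : EuclideanSpace ℂ (κ ⊕ Unit)),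
        (∀ k, a' (Sum.inl k) = a k) → a' (Sum.inr ()) = b →
        ‖rowOp Y a'‖ ^ 2 = ‖rowOp X a + b • D‖ ^ 2 ∧ ‖a'‖ ^ 2 = ‖a‖ ^ 2 + ‖b‖ ^ 2 := by
      intro a b a' h1 h2
      constructor
      · rw [norm_rowOp_sq, EuclideanSpace.norm_sq_eq, Fintype.sum_prod_type]
        simp [hY, Fintype.sum_sum_type, h1, h2]
      · simp [EuclideanSpace.norm_sq_eq, Fintype.sum_sum_type, h1, h2]
    have hYs : StrictRow Y := by
      intro a' ha'
      obtain ⟨h1, h2⟩ := rowY (WithLp.toLp 2 fun k => a' (Sum.inl k)) (a' (Sum.inr ())) a'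
        (fun _ => rfl) rfl
      refine lt_of_pow_lt_pow_left₀ 2 (norm_nonneg _) ?_
      rw [h1, h2]
      refine hD _ _ ?_
      by_contra! hcon
      rw [hcon.1, hcon.2] at h2
      exact ha' (by simpa using h2)
    set R : EuclideanSpace ℂ (κ ⊕ Unit) := WithLp.toLp 2 (Sum.elim r.ofLp fun _ => t) with hR
    have hRn : ‖R‖ ^ 2 = ‖r‖ ^ 2 + ‖t‖ ^ 2 := (rowY r t R (fun _ => rfl) rfl).2
    have hint := f.onType_intertwine hHX hYs
      (Matrix.of fun i k => Sum.elim (fun _ => R k) (fun i => if Sum.inl i = k then 1 else 0) i)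
      (fun j => by
        ext i k
        rcases i with i | i <;> rcases k with k | k <;>
        simp [rowExtension, Matrix.mul_apply, Fintype.sum_sum_type, hY, hR, ← hrt])
    have hle : ‖corner f H X‖ ^ 2 ≤ ‖rowOp (f.onType Y) R‖ ^ 2 := by
      rw [norm_rowOp_sq, EuclideanSpace.norm_sq_eq, Fintype.sum_prod_type]
      refine Finset.sum_le_sum fun j _ => ?_
      rw [Fintype.sum_sum_type]
      refine le_add_of_le_of_nonneg (Finset.sum_le_sum fun k _ => ?_)
        (Finset.sum_nonneg fun _ _ => by positivity)
      have h2 := congrFun₂ (congrArg Matrix.of.symm (hint j)) (Sum.inl ()) (Sum.inl k)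
      have h3 : corner f H X (j, k) = ∑ i, R i * f.onType Y j i (Sum.inl k) := by
        simpa [Matrix.mul_apply, Fintype.sum_sum_type, corner,
          onType_rowExtension_inl hf0 hHX] using h2
      rw [h3]
    have hR2 := pow_le_pow_left₀ (norm_nonneg _) ((f.onType_strictRow hYs).norm_le R) 2
    refine le_of_sq_le_sq ?_ (norm_nonneg _)
    rw [mul_pow]
    refine le_trans ?_ hnorm
    rw [← hRn]
    exact mul_le_mul_of_nonneg_left (hle.trans hR2) (sq_nonneg s)
  by_contra! hlt
  have hpos : 0 < ‖corner f H X‖ := (norm_nonneg _).trans_lt hlt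
  obtain ⟨s, hs1, hs2⟩ := exists_between ((div_lt_one hpos).2 hlt)
  have hs0 : 0 < s := (div_nonneg (norm_nonneg _) (norm_nonneg _)).trans_lt hs1
  rw [div_lt_iff₀ hpos] at hs1
  exact absurd (key s hs0 hs2) (not_le.2 hs1)

/-- By the maximum principle along `z ↦ corner f H (z X)`, a short row `H` is preserved over `X` if
and only if it is preserved over `0`. -/
theorem exists_corner_eq_iff (hf0 : f.app 1 0 = 0) {X : Fin d → Matrix κ κ ℂ}
    (hX : StrictRow X) :
    ∃ r > 0, ∀ H : EuclideanSpace ℂ (Fin d × κ), ‖H‖ < r →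
      StrictRow (rowExtension H X) ∧ (corner f H X = H ↔ corner f H 0 = H) := by
  obtain ⟨c, hc0, hc1, hc⟩ := hX.exists_uniform
  set q : ℝ := (1 + c) / 2 with hq
  have hcq : c < q := by rw [hq]; linarith
  have hq0 : 0 < q := by rw [hq]; linarith
  have hq1 : q < 1 := by rw [hq]; linarith
  obtain ⟨ρ, hρ1, hρ⟩ : ∃ ρ : ℝ, 1 < ρ ∧ ρ * c ≤ q := by
    rcases hc0.eq_or_lt with h | h
    · exact ⟨2, one_lt_two, by rw [← h]; linarith⟩
    · exact ⟨q / c, (one_lt_div h).2 hcq, by rw [div_mul_cancel₀ _ h.ne']⟩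
  have hbound : ∀ z ∈ Metric.ball (0 : ℂ) ρ, ∀ a, ‖rowOp (z • X) a‖ ≤ q * ‖a‖ := by
    intro z hz a
    have hz' : ‖z‖ ≤ ρ := by simpa using (mem_ball_zero_iff.1 hz).le
    have : rowOp (z • X) a = z • rowOp X a := by
      ext p
      simp [Finset.mul_sum, mul_left_comm]
    rw [this, norm_smul]
    calc ‖z‖ * ‖rowOp X a‖ ≤ ρ * (c * ‖a‖) :=
          mul_le_mul hz' (hc a) (norm_nonneg _) (by linarith)
      _ = (ρ * c) * ‖a‖ := by ring
      _ ≤ q * ‖a‖ := mul_le_mul_of_nonneg_right hρ (norm_nonneg _)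
  refine ⟨√(1 - q ^ 2), Real.sqrt_pos.2 (by nlinarith), fun H hH => ?_⟩
  have hH2 : q ^ 2 + ‖H‖ ^ 2 < 1 := by
    have := (Real.lt_sqrt (norm_nonneg _)).1 hH
    linarith
  have hext : ∀ z ∈ Metric.ball (0 : ℂ) ρ, StrictRow (rowExtension H (z • X)) := fun z hz =>
    strictRow_rowExtension (hbound z hz) hH2
  have hstr : ∀ z ∈ Metric.ball (0 : ℂ) ρ, StrictRow (z • X) := fun z hz a ha =>
    (hbound z hz a).trans_lt (mul_lt_of_lt_one_left (norm_pos_iff.2 ha) hq1)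
  have h0mem : (0 : ℂ) ∈ Metric.ball (0 : ℂ) ρ := by
    simpa using (by linarith : 0 < ρ)
  have h1mem : (1 : ℂ) ∈ Metric.ball (0 : ℂ) ρ := by simpa using hρ1
  have hdiff : DifferentiableOn ℂ (fun z : ℂ => corner f H (z • X)) (Metric.ball 0 ρ) := by
    refine (differentiableOn_euclidean).2 fun p => ?_
    refine f.differentiableOn_onType_comp (fun j i k => ?_) hext _ _ _
    rcases i with i | i <;> rcases k with k | k <;> simp only [rowExtension] <;> dsimp
    · fun_prop
    · fun_prop
    · fun_prop
    · exact (differentiable_id.mul_const (X j i k)).differentiableOn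
  have hmax : ∀ z₀ ∈ Metric.ball (0 : ℂ) ρ, corner f H (z₀ • X) = H →
      ∀ z ∈ Metric.ball (0 : ℂ) ρ, corner f H (z • X) = H := by
    intro z₀ hz₀ heq z hz
    have := Complex.eqOn_of_isPreconnected_of_isMaxOn_norm
      (convex_ball (0 : ℂ) ρ).isPreconnected Metric.isOpen_ball hdiff hz₀ (fun w hw => by
        simp only [Set.mem_ofPred_eq, Function.comp_apply, heq]
        exact norm_corner_le hf0 (hstr w hw) (hext w hw)) hz
    simpa [heq] using this
  refine ⟨by simpa using hext 1 h1mem, fun h => ?_, fun h => ?_⟩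
  · simpa using hmax 1 h1mem (by simpa using h) 0 h0mem
  · simpa using hmax 0 h0mem (by simpa using h) 1 h1mem

end Corner

section FixedRows

variable {d : ℕ} {ι κ : Type*} [Fintype ι] [Fintype κ] {f : NCSelfMap d}

theorem eventually_norm_smul_lt {E : Type*} [NormedAddCommGroup E] [NormedSpace ℂ E] (v : E)
    {r : ℝ} (hr : 0 < r) : ∀ᶠ c : ℂ in nhds 0, ‖c • v‖ < r := by
  have h : Filter.Tendsto (fun c : ℂ => ‖c • v‖) (nhds 0) (nhds 0) :=
    Continuous.tendsto' (by fun_prop) _ _ (by simp)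
  exact h.eventually (gt_mem_nhds hr)

/-- Over the zero tuple, the corner map acts on a row through its scalar entries. -/
theorem corner_zero_entry {H : EuclideanSpace ℂ (Fin d × κ)} {v : EuclideanSpace ℂ (Fin d × Unit)}
    (hH : ‖H‖ < 1) (hv : ‖v‖ < 1) (c : κ → ℂ) (h : ∀ j, v (j, ()) = ∑ k, H (j, k) * c k)
    (j : Fin d) : corner f v 0 (j, ()) = ∑ k, corner f H 0 (j, k) * c k :=
  corner_intertwine (strictRow_rowExtension_zero hH) (strictRow_rowExtension_zero hv)
    (Matrix.of fun k _ => c k) (fun j => by simp) (fun j l => by simp [h]) j ()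

variable (f) in
/-- The directions in `ℂ^d` whose small multiples are preserved by the corner map at the origin. -/
noncomputable def fixedDirections : Submodule ℂ (EuclideanSpace ℂ (Fin d × Unit)) where
  carrier := {v | ∀ᶠ c : ℂ in nhds 0, corner f (c • v) 0 = c • v}
  zero_mem' := by
    refine Filter.Eventually.of_forall fun c => ?_
    ext ⟨j, _⟩
    have := corner_zero_entry (f := f) (H := (0 : EuclideanSpace ℂ (Fin d × Unit)))
      (v := 0) (by simp) (by simp) 0 (by simp) j
    simpa using this
  add_mem' := by
    intro v w hv hw
    filter_upwards [hv, hw, eventually_norm_smul_lt v (half_pos one_pos),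
      eventually_norm_smul_lt w (half_pos one_pos)] with c hcv hcw hv2 hw2
    set H : EuclideanSpace ℂ (Fin d × Bool) :=
      WithLp.toLp 2 fun p => if p.2 then (c • v) (p.1, ()) else (c • w) (p.1, ()) with hH
    have hHn : ‖H‖ < 1 := by
      have : ‖H‖ ^ 2 = ‖c • v‖ ^ 2 + ‖c • w‖ ^ 2 := by
        simp only [EuclideanSpace.norm_sq_eq, Fintype.sum_prod_type]
        simp [hH, Finset.sum_add_distrib]
      nlinarith [norm_nonneg H, norm_nonneg (c • v), norm_nonneg (c • w)]
    have hsum : ‖c • (v + w)‖ < 1 := by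
      rw [smul_add]
      exact (norm_add_le _ _).trans_lt (by linarith)
    ext ⟨j, _⟩
    have h1 := corner_zero_entry (f := f) hHn (hv2.trans (by norm_num))
      (fun b => if b then 1 else 0) (by simp [hH]) j
    have h2 := corner_zero_entry (f := f) hHn (hw2.trans (by norm_num))
      (fun b => if b then 0 else 1) (by simp [hH]) j
    have h3 := corner_zero_entry (f := f) hHn hsum (fun _ => 1) (by simp [hH]) j
    simp only [hcv, hcw] at h1 h2
    simp only [Fintype.sum_bool] at h1 h2 h3
    simp only [if_true, mul_one, mul_zero, add_zero, zero_add, Bool.false_eq_true,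
      if_false] at h1 h2 h3
    rw [h3, ← h1, ← h2, smul_add]
    rfl
  smul_mem' := by
    intro b v hv
    have ht : Filter.Tendsto (fun c : ℂ => c * b) (nhds 0) (nhds 0) :=
      Continuous.tendsto' (by fun_prop) _ _ (by simp)
    filter_upwards [ht.eventually hv] with c hc
    simpa [smul_smul] using hc

/-- Entries of a fixed point give fixed directions. -/
theorem entry_mem_fixedDirections (hf0 : f.app 1 0 = 0) {X : Fin d → Matrix κ κ ℂ}
    (hX : StrictRow X) (hfix : f.onType X = X) (i k : κ) :
    (WithLp.toLp 2 fun p => X p.1 i k : EuclideanSpace ℂ (Fin d × Unit)) ∈ fixedDirections f := by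
  classical
  obtain ⟨r, hr, h⟩ := exists_corner_eq_iff (f := f) hf0 hX
  set a : EuclideanSpace ℂ κ := EuclideanSpace.single i 1 with ha
  set v : EuclideanSpace ℂ (Fin d × Unit) := WithLp.toLp 2 fun p => X p.1 i k with hv
  change ∀ᶠ c : ℂ in nhds 0, corner f (c • v) 0 = c • v
  filter_upwards [eventually_norm_smul_lt (rowOp X a) hr,
    eventually_norm_smul_lt (rowOp X a) one_pos, eventually_norm_smul_lt v one_pos]
    with c hc1 hc2 hc3
  obtain ⟨hs, hiff⟩ := h _ hc1
  have h0 : corner f (c • rowOp X a) 0 = c • rowOp X a := by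
    refine hiff.1 ?_
    rw [← map_smul] at hs ⊢
    rw [corner_rowOp hf0 hX _ hs, hfix]
  ext ⟨j, _⟩
  have h1 := corner_zero_entry (f := f) hc2 hc3 (fun l => if l = k then 1 else 0)
    (fun j => by simp [ha, hv]) j
  rw [h1, h0]
  simp [ha, hv]

theorem onType_eq_self (hf0 : f.app 1 0 = 0) (htop : fixedDirections f = ⊤)
    {Z : Fin d → Matrix κ κ ℂ} (hZ : StrictRow Z) : f.onType Z = Z := by
  classical
  obtain ⟨r, hr, h⟩ := exists_corner_eq_iff (f := f) hf0 hZ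
  funext j
  ext i k
  set a : EuclideanSpace ℂ κ := EuclideanSpace.single i 1 with ha
  set v : κ → EuclideanSpace ℂ (Fin d × Unit) := fun l => WithLp.toLp 2 fun p => Z p.1 i l with hv
  have hfix : ∀ᶠ c : ℂ in nhds 0, ∀ l, corner f (c • v l) 0 = c • v l :=
    Filter.eventually_all.2 fun l =>
      show v l ∈ fixedDirections f from htop ▸ Submodule.mem_top
  have hlt : ∀ᶠ c : ℂ in nhds 0, ∀ l, ‖c • v l‖ < 1 :=
    Filter.eventually_all.2 fun l => eventually_norm_smul_lt (v l) one_pos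
  have hall := hfix.and (hlt.and ((eventually_norm_smul_lt (rowOp Z a) hr).and
    (eventually_norm_smul_lt (rowOp Z a) one_pos)))
  obtain ⟨c, ⟨hc1, hc2, hc3, hc4⟩, hc0⟩ :=
    ((hall.filter_mono nhdsWithin_le_nhds).and
      (self_mem_nhdsWithin (s := ({0}ᶜ : Set ℂ)))).exists
  obtain ⟨hs, hiff⟩ := h _ hc3
  have h0 : corner f (c • rowOp Z a) 0 = c • rowOp Z a := by
    ext ⟨j, l⟩
    have h1 := corner_zero_entry (f := f) hc4 (hc2 l) (fun m => if m = l then 1 else 0)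
      (fun j => by simp [ha, hv]) j
    rw [hc1] at h1
    simp only [mul_ite, mul_one, mul_zero, Finset.sum_ite_eq', Finset.mem_univ, if_true] at h1
    rw [← h1]
    simp [ha, hv]
  have h1 := hiff.2 h0
  rw [← map_smul] at hs h1
  rw [corner_rowOp hf0 hZ _ hs, map_smul, map_smul] at h1
  have h2 := congrArg (fun u : EuclideanSpace ℂ (Fin d × κ) => u (j, k))
    (smul_right_injective _ (show c ≠ 0 from hc0) h1)
  simpa [ha] using h2

end FixedRows

end NCSelfMap

/-- if the fixed point set at some level of an nc self-map fixing the
origin satisfies no common homogeneous linear relation, then the map is the identity. -/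
theorem stmt_17 {d n : ℕ} (f : NCSelfMap d) (hf0 : f.app 1 0 = 0)
    (hF : ∀ α : Fin d → ℂ, α ≠ 0 →
      ∃ X ∈ freeBall d n, f.app n X = X ∧ ∑ j, α j • X j ≠ 0) :
    ∀ m : ℕ, 1 ≤ m → ∀ Z ∈ freeBall d m, f.app m Z = Z := by
  intro m _ Z hZ
  have htop : f.fixedDirections = ⊤ := by
    by_contra hne
    obtain ⟨φ, hφ, hker⟩ := Submodule.exists_le_ker_of_lt_top _ (lt_top_iff_ne_top.2 hne)
    set α : Fin d → ℂ := fun j => φ (EuclideanSpace.single (j, ()) 1) with hα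
    have hexp : ∀ v : EuclideanSpace ℂ (Fin d × Unit), φ v = ∑ j, α j * v (j, ()) := by
      intro v
      have hv : v = ∑ j, v (j, ()) • EuclideanSpace.single (j, ()) (1 : ℂ) := by
        ext ⟨j, _⟩
        simp [Pi.single_apply]
      conv_lhs => rw [hv]
      simp [hα, mul_comm]
    obtain ⟨X, hX, hfix, hne⟩ := hF α (by
      intro h0
      apply hφ
      ext v
      simp [hexp, h0])
    apply hne
    ext i k
    have hmem := NCSelfMap.entry_mem_fixedDirections hf0 ((mem_freeBall_iff_s17 X).1 hX)
      ((f.onType_fin hX).trans hfix) i k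
    have h0 : φ _ = 0 := hker hmem
    rw [hexp] at h0
    simpa [Matrix.sum_apply] using h0
  rw [← f.onType_fin hZ]
  exact NCSelfMap.onType_eq_self hf0 htop ((mem_freeBall_iff_s17 Z).1 hZ)
end

section
/- Let f : 𝔅_d(n) → 𝔅_d(n) be holomorphic with f(0) = 0, and let Y ∈ 𝔅_d(n) be a nonzero point such that Σ_{j=1}^d Y_j Y_j* = r²·I for some real r with 0 < r < 1 (so that Y/r is a row coisometry), and suppose f(Y) = Y. Then the whole disc through 0 and Y in the coisometric direction consists of fixed points: f(z·(Y/r)) = z·(Y/r) for every z ∈ ℂ with |z| < 1. -/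
open Matrix
open scoped ComplexOrder

attribute [local instance] Matrix.normedAddCommGroup Matrix.normedSpace

/-- The squared norm of row `i` of a tuple, viewed as a single vector, is the `i`-th diagonal
entry of `∑ j, X j * (X j)ᴴ`. -/
lemma sum_mul_conjTranspose_diag {d n : ℕ} (X : MatTuple d n) (i : Fin n) :
    (∑ j, X j * (X j)ᴴ) i i =
      ((‖WithLp.toLp 2 (fun p : Fin d × Fin n => X p.1 i p.2)‖ ^ 2 : ℝ) : ℂ) := by
  rw [EuclideanSpace.norm_sq_eq, Fintype.sum_prod_type, Matrix.sum_apply]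
  push_cast
  refine Finset.sum_congr rfl fun j _ => ?_
  rw [Matrix.mul_apply]
  refine Finset.sum_congr rfl fun k _ => ?_
  rw [Matrix.conjTranspose_apply]
  exact Complex.mul_conj' _

/-- Every row of a point of the free ball has norm less than one. -/
lemma norm_row_lt_one {d n : ℕ} {X : MatTuple d n} (hX : X ∈ freeBall d n) (i : Fin n) :
    ‖WithLp.toLp 2 (fun p : Fin d × Fin n => X p.1 i p.2)‖ < 1 := by
  have h : 0 < (1 - ∑ j, X j * (X j)ᴴ) i i := Matrix.PosDef.diag_pos hX
  rw [Matrix.sub_apply, Matrix.one_apply_eq, sum_mul_conjTranspose_diag, sub_pos,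
    ← Complex.ofReal_one, Complex.real_lt_real] at h
  exact (sq_lt_one_iff₀ (norm_nonneg _)).mp h

/-- The open disc in the direction of a row coisometry lies in the free ball. -/
lemma smul_mem_freeBall {d n : ℕ} {W : MatTuple d n} (hW : ∑ j, W j * (W j)ᴴ = 1)
    {z : ℂ} (hz : ‖z‖ < 1) : z • W ∈ freeBall d n := by
  have h : (1 - ∑ j, (z • W) j * ((z • W) j)ᴴ) =
      ((1 - ‖z‖ ^ 2 : ℝ) : ℂ) • (1 : Matrix (Fin n) (Fin n) ℂ) := by
    have h1 : ∑ j, (z • W) j * ((z • W) j)ᴴ = (z * star z) • ∑ j, W j * (W j)ᴴ := by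
      rw [Finset.smul_sum]
      refine Finset.sum_congr rfl fun j _ => ?_
      simp [Matrix.conjTranspose_smul, smul_smul, mul_comm]
    have h2 : z * star z = (‖z‖ : ℂ) ^ 2 := Complex.mul_conj' z
    rw [h1, hW, h2]
    push_cast
    rw [sub_smul, one_smul]
  change Matrix.PosDef _
  rw [h]
  refine Matrix.PosDef.one.smul ?_
  exact Complex.zero_lt_real.mpr (sub_pos.mpr ((sq_lt_one_iff₀ (norm_nonneg _)).mpr hz))

/-- a holomorphic self-map of a level of the free ball fixing `0` and a
nonzero scalar multiple `Y` of a row coisometry fixes the whole disc through `0` and `Y`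
in the coisometric direction. -/
theorem stmt_18 {d n : ℕ} (hd : 0 < d) (hn : 0 < n)
    (f : MatTuple d n → MatTuple d n)
    (hmaps : Set.MapsTo f (freeBall d n) (freeBall d n))
    (hf : DifferentiableOn ℂ f (freeBall d n)) (hf0 : f 0 = 0)
    (Y : MatTuple d n) (hY : Y ∈ freeBall d n) (hY0 : Y ≠ 0)
    (r : ℝ) (hr0 : 0 < r) (hr1 : r < 1)
    (hco : ∑ j, Y j * (Y j)ᴴ = ((r : ℂ) ^ 2) • (1 : Matrix (Fin n) (Fin n) ℂ))
    (hfix : f Y = Y) :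
    ∀ z : ℂ, ‖z‖ < 1 → f (z • (r : ℂ)⁻¹ • Y) = z • (r : ℂ)⁻¹ • Y := by
  intro z hz
  set W : MatTuple d n := (r : ℂ)⁻¹ • Y with hWdef
  have hrc : (r : ℂ) ≠ 0 := Complex.ofReal_ne_zero.mpr hr0.ne'
  have hYW : Y = (r : ℂ) • W := by rw [hWdef, smul_inv_smul₀ hrc]
  have hW : ∑ j, W j * (W j)ᴴ = 1 := by
    have h1 : ∑ j, W j * (W j)ᴴ = ((r : ℂ)⁻¹ * (r : ℂ)⁻¹) • ∑ j, Y j * (Y j)ᴴ := by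
      rw [Finset.smul_sum]
      refine Finset.sum_congr rfl fun j _ => ?_
      simp [hWdef, Matrix.conjTranspose_smul, smul_smul]
    rw [h1, hco, smul_smul]
    convert one_smul ℂ _ using 2
    field_simp
  funext j
  ext i k
  let v : ℂ → EuclideanSpace ℂ (Fin d × Fin n) :=
    fun z => WithLp.toLp 2 fun p => f (z • W) p.1 i p.2
  have hv0 : v 0 = 0 := by
    ext p
    simp [v, hf0]
  have hg : DifferentiableOn ℂ (fun z : ℂ => f (z • W)) (Metric.ball 0 1) :=
    hf.comp (by fun_prop) fun z hz => smul_mem_freeBall hW (by simpa using hz)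
  have hv : DifferentiableOn ℂ v (Metric.ball 0 1) := by
    refine (differentiableOn_euclidean (𝕜 := ℂ)).mpr fun p => ?_
    exact differentiableOn_pi.mp (differentiableOn_pi.mp (differentiableOn_pi.mp hg p.1) i) p.2
  have hvmaps : Set.MapsTo v (Metric.ball 0 1) (Metric.ball (v 0) 1) := fun z hz => by
    rw [hv0, mem_ball_zero_iff]
    exact norm_row_lt_one (hmaps (smul_mem_freeBall hW (by simpa using hz))) i
  have hvr : v r = WithLp.toLp 2 (fun p : Fin d × Fin n => Y p.1 i p.2) := by
    simp only [v, ← hYW, hfix]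
  have hnorm : ‖v r‖ = r := by
    have h := sum_mul_conjTranspose_diag Y i
    rw [hco, Matrix.smul_apply, Matrix.one_apply_eq, smul_eq_mul, mul_one, ← hvr] at h
    exact ((sq_eq_sq₀ hr0.le (norm_nonneg _)).mp (by exact_mod_cast h)).symm
  have hslope : dslope v 0 r = (r : ℂ)⁻¹ • v r := by
    rw [dslope_of_ne _ hrc, slope_def_module, hv0, sub_zero, sub_zero]
  have hrball : (r : ℂ) ∈ Metric.ball (0 : ℂ) 1 := by
    simpa [abs_of_pos hr0] using hr1
  have hlin := Complex.affine_of_mapsTo_ball_of_norm_dslope_eq_div hv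
    (hvmaps.mono_right Metric.ball_subset_closedBall) hrball (by
    rw [hslope, norm_smul, hnorm, norm_inv, Complex.norm_real, Real.norm_of_nonneg hr0.le,
      inv_mul_cancel₀ hr0.ne', div_one])
  have hz' := hlin (show z ∈ Metric.ball (0 : ℂ) 1 by simpa using hz)
  rw [hslope, hv0, hvr] at hz'
  have := congrArg (fun u : EuclideanSpace ℂ (Fin d × Fin n) => u (j, k)) hz'
  simpa [v, hWdef] using this
end
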